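/- arXiv:2501.00902 — 10 statements merged into one kernel-verified Lean document; each statement's English description precedes it below -/
import Mathlib

section
/- Let f : ℂ → ℂ be entire (differentiable on all of ℂ) and let K ⊆ ℂ be a compact set. Then for every real C > 1 there exists a constant M > 0 such that for every natural number n there is a polynomial p with complex coefficients of degree at most n satisfying sup_{z ∈ K} |f(z) − p(z)| ≤ M · C^{−n}. (Polynomial approximation of entire functions converges superexponentially on every compact set.) -/
/-- Cauchy's estimate for the terms of the Taylor series at `0` of an entire function:
on the disc of radius `r` they decay geometrically with any prescribed ratio `C⁻¹`. -/
theorem Differentiable.exists_norm_taylor_term_le {f : ℂ → ℂ} (hf : Differentiable ℂ f)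
    {r C : ℝ} (hr : 0 < r) (hC : 0 < C) :
    ∃ B : ℝ, 0 < B ∧ ∀ z : ℂ, ‖z‖ ≤ r → ∀ k : ℕ,
      ‖(k.factorial : ℂ)⁻¹ * iteratedDeriv k f 0 * z ^ k‖ ≤ B * C⁻¹ ^ k := by
  obtain ⟨B, hB⟩ := (isCompact_sphere (0 : ℂ) (r * C)).exists_bound_of_continuousOn
    hf.continuous.continuousOn
  refine ⟨max B 1, by positivity, fun z hz k => ?_⟩
  have hderiv : ‖iteratedDeriv k f 0‖ ≤ k.factorial * max B 1 / (r * C) ^ k :=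
    Complex.norm_iteratedDeriv_le_of_forall_mem_sphere_norm_le k (by positivity)
      hf.diffContOnCl fun w hw => (hB w hw).trans (le_max_left _ _)
  have hfact : (k.factorial : ℝ) ≠ 0 := by positivity
  calc ‖(k.factorial : ℂ)⁻¹ * iteratedDeriv k f 0 * z ^ k‖
      = (k.factorial : ℝ)⁻¹ * ‖iteratedDeriv k f 0‖ * ‖z‖ ^ k := by simp
    _ ≤ (k.factorial : ℝ)⁻¹ * (k.factorial * max B 1 / (r * C) ^ k) * r ^ k := by gcongr
    _ = max B 1 * C⁻¹ ^ k := by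
      rw [mul_pow, inv_pow]
      field_simp

/-- Polynomial approximation of entire functions converges superexponentially
on every compact set `K ⊆ ℂ`. -/
theorem entire_superexponential_polynomial_approx
    (f : ℂ → ℂ) (hf : Differentiable ℂ f) (K : Set ℂ) (hK : IsCompact K) :
    ∀ C : ℝ, 1 < C → ∃ M : ℝ, 0 < M ∧ ∀ n : ℕ, ∃ p : Polynomial ℂ,
      p.natDegree ≤ n ∧ ∀ z ∈ K, ‖f z - p.eval z‖ ≤ M * C ^ (-(n : ℤ)) := by
  intro C hC
  have hC0 : 0 < C := one_pos.trans hC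
  have hCinv : C⁻¹ < 1 := inv_lt_one_of_one_lt₀ hC
  have hgap : 0 < 1 - C⁻¹ := sub_pos.mpr hCinv
  obtain ⟨r, hr, hKr⟩ := hK.isBounded.exists_pos_norm_le
  obtain ⟨B, hB, hterm⟩ := hf.exists_norm_taylor_term_le hr hC0
  refine ⟨B / (1 - C⁻¹), by positivity, fun n =>
    ⟨∑ k ∈ Finset.range (n + 1),
      Polynomial.monomial k ((k.factorial : ℂ)⁻¹ * iteratedDeriv k f 0), ?_, fun z hz => ?_⟩⟩
  · exact Polynomial.natDegree_sum_le_of_forall_le _ _ fun k hk =>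
      (Polynomial.natDegree_monomial_le _).trans (Finset.mem_range_succ_iff.mp hk)
  · have hsum : HasSum (fun k : ℕ => (k.factorial : ℂ)⁻¹ * iteratedDeriv k f 0 * z ^ k)
        (f z) := by
      convert! Complex.hasSum_taylorSeries_of_entire hf 0 z using 2 with k
      simp only [sub_zero, smul_eq_mul]
      ring
    have htail := norm_sub_le_of_geometric_bound_of_hasSum hCinv (hterm z (hKr z hz)) hsum (n + 1)
    rw [norm_sub_rev, Polynomial.eval_finsetSum]
    simp only [Polynomial.eval_monomial]
    calc _ ≤ B * C⁻¹ ^ (n + 1) / (1 - C⁻¹) := htail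
      _ ≤ B * C⁻¹ ^ n / (1 - C⁻¹) := by
        have := pow_le_pow_of_le_one (inv_nonneg.mpr hC0.le) hCinv.le n.le_succ
        gcongr
      _ = B / (1 - C⁻¹) * C ^ (-(n : ℤ)) := by
        rw [zpow_neg, zpow_natCast, inv_pow]
        ring
end

section
/- Let f : ℂ → ℂ be continuous on the closed unit disk {z : |z| ≤ 1}, and suppose there exist constants M > 0 and C with 0 < C < 1 such that for every natural number n there is a polynomial p_n of degree at most n with sup_{|z| ≤ 1} |f(z) − p_n(z)| ≤ M · C^n. Then there exists a function g holomorphic on the open disk {z : |z| < 1/C} that agrees with f on the closed unit disk. (Converse Bernstein-type theorem: exponential decay of polynomial minimax errors at rate C forces analytic continuation to the disk of radius 1/C; polynomial convergence is limited by the nearest singularity.) -/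
/-- Bernstein's growth inequality: a polynomial of degree at most `n` bounded by `K` on the unit
circle is bounded by `K * ‖z‖ ^ n` outside the open unit disk. -/
theorem Polynomial.norm_eval_le_mul_norm_pow {p : Polynomial ℂ} {n : ℕ} {K : ℝ}
    (hdeg : p.natDegree ≤ n) (hK : ∀ z : ℂ, ‖z‖ = 1 → ‖p.eval z‖ ≤ K) {z : ℂ} (hz : 1 ≤ ‖z‖) :
    ‖p.eval z‖ ≤ K * ‖z‖ ^ n := by
  have eval_eq : ∀ w : ℂ, w ≠ 0 → (p.reflect n).eval w⁻¹ * w ^ n = p.eval w := by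
    intro w hw
    let : Invertible w := invertibleOfNonzero hw
    simpa [Polynomial.eval₂_id] using
      Polynomial.eval₂_reflect_mul_pow (RingHom.id ℂ) w n p hdeg
  have hz0 : z ≠ 0 := norm_pos_iff.mp (zero_lt_one.trans_le hz)
  have reflect_le : ‖(p.reflect n).eval z⁻¹‖ ≤ K := by
    refine Complex.norm_le_of_forall_mem_frontier_norm_le (U := Metric.ball (0 : ℂ) 1)
      Metric.isBounded_ball (p.reflect n).differentiable.diffContOnCl ?_ ?_
    · intro w hw
      have hw1 : ‖w‖ = 1 := by
        simpa [frontier_ball (0 : ℂ) one_ne_zero] using hw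
      have hw0 : w ≠ 0 := norm_pos_iff.mp (hw1 ▸ zero_lt_one)
      have h := eval_eq w⁻¹ (inv_ne_zero hw0)
      have hinv : ‖w⁻¹‖ = 1 := by rw [norm_inv, hw1, inv_one]
      have hle := hK w⁻¹ hinv
      rw [← h, inv_inv, norm_mul, norm_pow, hinv, one_pow, mul_one] at hle
      exact hle
    · rw [closure_ball (0 : ℂ) one_ne_zero, mem_closedBall_zero_iff, norm_inv]
      exact inv_le_one_of_one_le₀ hz
  rw [← eval_eq z hz0, norm_mul, norm_pow]
  gcongr

open Filter Topology in
/-- Converse Bernstein-type theorem: exponential decay of polynomial minimax errors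
at rate `C` on the closed unit disk forces analytic continuation to the disk of
radius `1/C`. -/
theorem exponential_polynomial_approx_implies_analytic_continuation
    (f : ℂ → ℂ) (hf : ContinuousOn f (Metric.closedBall (0 : ℂ) 1))
    (M C : ℝ) (hM : 0 < M) (hC0 : 0 < C) (hC1 : C < 1)
    (happrox : ∀ n : ℕ, ∃ p : Polynomial ℂ, p.natDegree ≤ n ∧
      ∀ z ∈ Metric.closedBall (0 : ℂ) 1, ‖f z - p.eval z‖ ≤ M * C ^ n) :
    ∃ g : ℂ → ℂ, DifferentiableOn ℂ g (Metric.ball (0 : ℂ) (1 / C)) ∧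
      ∀ z ∈ Metric.closedBall (0 : ℂ) 1, g z = f z := by
  choose p hdeg hp using happrox
  let d : ℕ → Polynomial ℂ := fun n => p (n + 1) - p n
  have d_deg : ∀ n, (d n).natDegree ≤ n + 1 := fun n =>
    (Polynomial.natDegree_sub_le_of_le (hdeg (n + 1)) (hdeg n)).trans (max_le le_rfl n.le_succ)
  have d_le_disk : ∀ n (z : ℂ), ‖z‖ ≤ 1 → ‖(d n).eval z‖ ≤ 2 * M * C ^ n := by
    intro n z hz
    have hz' := mem_closedBall_zero_iff.mpr hz
    calc ‖(d n).eval z‖ = ‖(f z - (p n).eval z) - (f z - (p (n + 1)).eval z)‖ := by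
          simp [d]
      _ ≤ M * C ^ n + M * C ^ (n + 1) :=
          (norm_sub_le _ _).trans (add_le_add (hp n z hz') (hp (n + 1) z hz'))
      _ ≤ M * C ^ n + M * C ^ n := by
          gcongr M * C ^ n + M * ?_
          exact pow_le_pow_of_le_one hC0.le hC1.le n.le_succ
      _ = 2 * M * C ^ n := by ring
  have d_le : ∀ r : ℝ, 1 ≤ r → ∀ n (z : ℂ), ‖z‖ ≤ r →
      ‖(d n).eval z‖ ≤ 2 * M * r * (C * r) ^ n := by
    intro r hr n z hz
    have hform : 2 * M * r * (C * r) ^ n = 2 * M * C ^ n * r ^ (n + 1) := by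
      rw [mul_pow]; ring
    rw [hform]
    rcases le_total ‖z‖ 1 with h | h
    · exact (d_le_disk n z h).trans (le_mul_of_one_le_right (by positivity) (one_le_pow₀ hr))
    · refine (Polynomial.norm_eval_le_mul_norm_pow (d_deg n)
        (fun w hw => d_le_disk n w hw.le) h).trans ?_
      gcongr
  have geom_summable : ∀ r : ℝ, 1 ≤ r → r < 1 / C →
      Summable fun n : ℕ => 2 * M * r * (C * r) ^ n := by
    intro r hr hrC
    refine (summable_geometric_of_lt_one (by positivity) ?_).mul_left _
    rwa [mul_comm, ← lt_div_iff₀ hC0]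
  have hC : 1 < 1 / C := (one_lt_div hC0).mpr hC1
  refine ⟨fun z => (p 0).eval z + ∑' n, (d n).eval z, ?_, ?_⟩
  · intro z hz
    obtain ⟨r, hr, hrC⟩ := exists_between (max_lt hC (mem_ball_zero_iff.mp hz))
    obtain ⟨hr1, hzr⟩ := max_lt_iff.mp hr
    have h := Complex.differentiableOn_tsum_of_summable_norm (geom_summable r hr1.le hrC)
      (fun n => (d n).differentiable.differentiableOn) Metric.isOpen_ball
      (fun n w hw => d_le r hr1.le n w (mem_ball_zero_iff.mp hw).le)
    exact ((p 0).differentiable.differentiableAt.add (h.differentiableAt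
      (Metric.isOpen_ball.mem_nhds (mem_ball_zero_iff.mpr hzr)))).differentiableWithinAt
  · intro z hz
    have hsum : Summable fun n => (d n).eval z :=
      .of_norm_bounded (geom_summable 1 le_rfl hC)
        fun n => d_le 1 le_rfl n z (mem_closedBall_zero_iff.mp hz)
    have p_tendsto : Tendsto (fun n => (p n).eval z) atTop (𝓝 (f z)) := by
      refine tendsto_iff_norm_sub_tendsto_zero.mpr (squeeze_zero (fun _ => norm_nonneg _)
        (fun n => (norm_sub_rev _ _).trans_le (hp n z hz)) ?_)
      simpa using (tendsto_pow_atTop_nhds_zero_of_lt_one hC0.le hC1).const_mul M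
    have partial_sum : ∀ n, ∑ i ∈ Finset.range n, (d i).eval z = (p n).eval z - (p 0).eval z := by
      intro n
      simpa [d] using Finset.sum_range_sub (fun i => (p i).eval z) n
    have hlim := hsum.hasSum.tendsto_sum_nat
    simp only [partial_sum] at hlim
    simp [tendsto_nhds_unique hlim (p_tendsto.sub_const _)]
end

section
/- Let K ⊆ ℂ be compact, let g : ℂ → ℂ be entire, let p₀ and q₀ be complex polynomials with q₀ nonvanishing on K, let m = deg q₀, and set f(z) = g(z) + p₀(z)/q₀(z) for z ∈ K. Then for every real C > 1 there exists M > 0 such that for every natural number n with n ≥ max(m, deg p₀) there exist polynomials p and q of degree at most n, with q nonvanishing on K, satisfying sup_{z ∈ K} |f(z) − p(z)/q(z)| ≤ M · C^{−n}. (Rational approximants can 'peel off' the poles of a function that is entire apart from a rational part, so rational minimax errors still decrease superexponentially.) -/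
open Polynomial in
/-- On a bounded set, an entire function is approximated by polynomials of degree at most `k`
with an error decreasing faster than any prescribed geometric rate. -/
theorem Differentiable.exists_polynomial_geometric_approx {g : ℂ → ℂ} (hg : Differentiable ℂ g)
    {K : Set ℂ} (hK : Bornology.IsBounded K) {C : ℝ} (hC : 1 < C) :
    ∃ A : ℝ, 0 < A ∧ ∀ k : ℕ, ∃ t : ℂ[X], t.natDegree ≤ k ∧
      ∀ z ∈ K, ‖g z - t.eval z‖ ≤ A * C⁻¹ ^ k := by
  obtain ⟨B, hB, hKB⟩ := hK.exists_pos_norm_le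
  have hC0 : 0 < C := one_pos.trans hC
  let r : NNReal := ⟨C * B, by positivity⟩
  obtain ⟨a, ha, A, hA, happrox⟩ :=
    (hg.hasFPowerSeriesOnBall 0 one_pos).uniform_geometric_approx' (ENNReal.coe_lt_top (r := r))
  refine ⟨A, hA, fun k => ?_⟩
  let P := cauchyPowerSeries g 0 (1 : NNReal)
  refine ⟨∑ i ∈ Finset.range k, Polynomial.C (P.coeff i) * X ^ i, ?_, fun z hz => ?_⟩
  · refine natDegree_sum_le_of_forall_le _ _ fun i hi => ?_
    exact (natDegree_C_mul_X_pow_le _ _).trans (Finset.mem_range.1 hi).le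
  · have hzB := hKB z hz
    have hr : (r : ℝ) = C * B := rfl
    have hzr : z ∈ Metric.ball (0 : ℂ) r := by
      rw [mem_ball_zero_iff, hr]
      nlinarith
    have heval : (∑ i ∈ Finset.range k, Polynomial.C (P.coeff i) * X ^ i).eval z =
        P.partialSum k z := by
      rw [eval_finsetSum, FormalMultilinearSeries.partialSum]
      refine Finset.sum_congr rfl fun i _ => ?_
      rw [FormalMultilinearSeries.apply_eq_pow_smul_coeff, smul_eq_mul, eval_mul, eval_C,
        eval_pow, eval_X, mul_comm]
    have h := happrox z hzr k
    rw [zero_add] at h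
    rw [heval]
    refine h.trans ?_
    have ha0 := ha.1
    gcongr
    calc a * (‖z‖ / r) ≤ 1 * (B / (C * B)) := by
          rw [hr]
          gcongr
          exact ha.2.le
      _ = C⁻¹ := by field_simp

/-- Rational approximants can "peel off" the poles of a function which is entire
apart from a rational part, so rational minimax errors still decrease
superexponentially. -/
theorem meromorphic_superexponential_rational_approx
    (K : Set ℂ) (hK : IsCompact K) (g : ℂ → ℂ) (hg : Differentiable ℂ g)
    (p₀ q₀ : Polynomial ℂ) (hq₀ : ∀ z ∈ K, q₀.eval z ≠ 0)
    (f : ℂ → ℂ) (hf : ∀ z ∈ K, f z = g z + p₀.eval z / q₀.eval z) :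
    ∀ C : ℝ, 1 < C → ∃ M : ℝ, 0 < M ∧
      ∀ n : ℕ, max q₀.natDegree p₀.natDegree ≤ n →
        ∃ p q : Polynomial ℂ, p.natDegree ≤ n ∧ q.natDegree ≤ n ∧
          (∀ z ∈ K, q.eval z ≠ 0) ∧
          ∀ z ∈ K, ‖f z - p.eval z / q.eval z‖ ≤ M * C ^ (-(n : ℤ)) := by
  intro C hC
  have hC0 : 0 < C := one_pos.trans hC
  obtain ⟨A, hA, happrox⟩ := hg.exists_polynomial_geometric_approx hK.isBounded hC
  refine ⟨A * C ^ q₀.natDegree, by positivity, fun n hn => ?_⟩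
  obtain ⟨hqn, hpn⟩ := max_le_iff.1 hn
  obtain ⟨t, htdeg, ht⟩ := happrox (n - q₀.natDegree)
  refine ⟨t * q₀ + p₀, q₀, ?_, hqn, hq₀, fun z hz => ?_⟩
  · refine Polynomial.natDegree_add_le_of_degree_le ?_ hpn
    exact Polynomial.natDegree_mul_le.trans (by omega)
  · have hq := hq₀ z hz
    have herr : f z - (t * q₀ + p₀).eval z / q₀.eval z = g z - t.eval z := by
      rw [hf z hz, Polynomial.eval_add, Polynomial.eval_mul]
      field_simp
      ring
    rw [herr]
    refine (ht z hz).trans_eq ?_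
    rw [mul_assoc, zpow_neg, zpow_natCast, inv_pow]
    congr 1
    rw [pow_sub₀ C hC0.ne' hqn]
    field_simp
end

section
/- Let S ⊆ ℂ be a finite set, let f : ℂ → ℂ be holomorphic on ℂ \ S, and let K ⊆ ℂ be a compact set with K ∩ S = ∅. Then for every real C > 1 there exists M > 0 such that for every natural number n there exist polynomials p and q of degree at most n, with q nonvanishing on K, satisfying sup_{z ∈ K} |f(z) − p(z)/q(z)| ≤ M · C^{−n}. (Rational minimax errors decrease superexponentially for functions holomorphic off a finite set, even when the isolated singularities are essential singularities.) -/
open Metric Set Filter Topology Complex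

/-- A coefficient sequence that decays faster than every geometric sequence. -/
def SuperexponentialDecay (a : ℕ → ℂ) : Prop :=
  ∀ ρ : ℝ, 0 < ρ → ∃ M : ℝ, ∀ k, ‖a k‖ ≤ M * ρ ^ k

/-- On `K`, the function `f` is approximable with superexponentially small error by rational
functions whose degrees are `N` times the index. -/
def RationallyApproximable (N : ℕ) (f : ℂ → ℂ) (K : Set ℂ) : Prop :=
  ∀ C : ℝ, 1 < C → ∃ M : ℝ, 0 < M ∧ ∀ n : ℕ,
    ∃ p q : Polynomial ℂ, p.natDegree ≤ N * n ∧ q.natDegree ≤ N * n ∧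
      (∀ z ∈ K, q.eval z ≠ 0) ∧
      ∀ z ∈ K, ‖f z - p.eval z / q.eval z‖ ≤ M * (C ^ n)⁻¹

theorem RationallyApproximable.add {N₁ N₂ : ℕ} {f g h : ℂ → ℂ} {K : Set ℂ}
    (hf : RationallyApproximable N₁ f K) (hg : RationallyApproximable N₂ g K)
    (hfg : ∀ z ∈ K, h z = f z + g z) : RationallyApproximable (N₁ + N₂) h K := by
  intro C hC
  obtain ⟨M₁, hM₁, h₁⟩ := hf C hC
  obtain ⟨M₂, hM₂, h₂⟩ := hg C hC
  refine ⟨M₁ + M₂, by positivity, fun n => ?_⟩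
  obtain ⟨p₁, q₁, hp₁, hq₁, hz₁, he₁⟩ := h₁ n
  obtain ⟨p₂, q₂, hp₂, hq₂, hz₂, he₂⟩ := h₂ n
  refine ⟨p₁ * q₂ + p₂ * q₁, q₁ * q₂, ?_, ?_, ?_, ?_⟩
  · refine (Polynomial.natDegree_add_le _ _).trans (max_le ?_ ?_)
    · exact Polynomial.natDegree_mul_le.trans (by rw [add_mul]; omega)
    · exact Polynomial.natDegree_mul_le.trans (by rw [add_mul]; omega)
  · exact Polynomial.natDegree_mul_le.trans (by rw [add_mul]; omega)
  · intro z hz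
    rw [Polynomial.eval_mul]
    exact mul_ne_zero (hz₁ z hz) (hz₂ z hz)
  · intro z hz
    have e : h z - (p₁ * q₂ + p₂ * q₁).eval z / (q₁ * q₂).eval z =
        (f z - p₁.eval z / q₁.eval z) + (g z - p₂.eval z / q₂.eval z) := by
      have := hz₁ z hz
      have := hz₂ z hz
      rw [hfg z hz]
      simp only [Polynomial.eval_add, Polynomial.eval_mul]
      field_simp
      ring
    rw [e, add_mul]
    exact (norm_add_le _ _).trans (add_le_add (he₁ z hz) (he₂ z hz))

/-- The terms of a power series with superexponentially decaying coefficients are dominated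
by any geometric sequence, uniformly on bounded sets. -/
theorem SuperexponentialDecay.exists_norm_mul_pow_le {a : ℕ → ℂ} (ha : SuperexponentialDecay a)
    (B : ℝ) {ρ : ℝ} (hρ : 0 < ρ) :
    ∃ M : ℝ, 0 < M ∧ ∀ u : ℂ, ‖u‖ ≤ B → ∀ k, ‖a k * u ^ k‖ ≤ M * ρ ^ k := by
  have hB : 0 < |B| + 1 := by positivity
  obtain ⟨M, hM⟩ := ha (ρ / (|B| + 1)) (by positivity)
  have hM0 : 0 ≤ M := by simpa using (norm_nonneg _).trans (hM 0)
  refine ⟨M + 1, by positivity, fun u hu k => ?_⟩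
  have hu' : ‖u‖ ≤ |B| + 1 := hu.trans ((le_abs_self B).trans (by linarith))
  calc ‖a k * u ^ k‖ = ‖a k‖ * ‖u‖ ^ k := by rw [norm_mul, norm_pow]
    _ ≤ (M * (ρ / (|B| + 1)) ^ k) * (|B| + 1) ^ k := by gcongr; exact hM k
    _ = M * ρ ^ k := by rw [mul_assoc, ← mul_pow, div_mul_cancel₀ _ hB.ne']
    _ ≤ (M + 1) * ρ ^ k := by gcongr; linarith

theorem SuperexponentialDecay.exists_norm_partial_sum_sub_le {a : ℕ → ℂ}
    (ha : SuperexponentialDecay a) (B : ℝ) {C : ℝ} (hC : 1 < C) :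
    ∃ M : ℝ, 0 < M ∧ ∀ u v : ℂ, ‖u‖ ≤ B → HasSum (fun k => a k * u ^ k) v → ∀ n : ℕ,
      ‖v - ∑ k ∈ Finset.range n, a k * u ^ k‖ ≤ M * (C ^ n)⁻¹ := by
  obtain ⟨M, hM, h⟩ := ha.exists_norm_mul_pow_le B (ρ := C⁻¹) (by positivity)
  have hC1 : C⁻¹ < 1 := inv_lt_one_of_one_lt₀ hC
  refine ⟨M / (1 - C⁻¹), div_pos hM (by linarith), fun u v hu hv n => ?_⟩
  rw [norm_sub_rev]
  refine (norm_sub_le_of_geometric_bound_of_hasSum hC1 (h u hu) hv n).trans (le_of_eq ?_)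
  rw [inv_pow]
  ring

theorem SuperexponentialDecay.summable {a : ℕ → ℂ} (ha : SuperexponentialDecay a) (u : ℂ) :
    Summable fun k => a k * u ^ k := by
  obtain ⟨M, -, h⟩ := ha.exists_norm_mul_pow_le ‖u‖ (ρ := 1 / 2) (by norm_num)
  exact .of_norm_bounded
    ((summable_geometric_of_lt_one (r := 1 / 2) (by norm_num) (by norm_num)).mul_left M) (h u le_rfl)

theorem SuperexponentialDecay.differentiable_tsum {a : ℕ → ℂ} (ha : SuperexponentialDecay a) :
    Differentiable ℂ fun u => ∑' k, a k * u ^ k := by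
  intro u
  obtain ⟨M, -, h⟩ := ha.exists_norm_mul_pow_le (‖u‖ + 1) (ρ := 1 / 2) (by norm_num)
  refine (differentiableOn_tsum_of_summable_norm (U := ball 0 (‖u‖ + 1))
    ((summable_geometric_of_lt_one (r := 1 / 2) (by norm_num) (by norm_num)).mul_left M)
    (fun k => by fun_prop) isOpen_ball fun k w hw => ?_).differentiableAt
    (isOpen_ball.mem_nhds (by simp))
  exact h w (by simpa using (mem_ball_zero_iff.1 hw).le) k

theorem superexponentialDecay_taylor {f : ℂ → ℂ} (hf : Differentiable ℂ f) :
    SuperexponentialDecay fun k => (k.factorial : ℂ)⁻¹ * iteratedDeriv k f 0 := by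
  intro ρ hρ
  obtain ⟨M, hM⟩ := (isCompact_sphere (0 : ℂ) ρ⁻¹).exists_bound_of_continuousOn
    hf.continuous.continuousOn
  refine ⟨M, fun k => ?_⟩
  have := norm_iteratedDeriv_le_of_forall_mem_sphere_norm_le k (inv_pos.2 hρ)
    hf.diffContOnCl hM
  have hk : (0 : ℝ) < k.factorial := by positivity
  rw [norm_mul, norm_inv, Complex.norm_natCast]
  calc (k.factorial : ℝ)⁻¹ * ‖iteratedDeriv k f 0‖
      ≤ (k.factorial : ℝ)⁻¹ * (k.factorial * M / ρ⁻¹ ^ k) := by gcongr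
    _ = M * ρ ^ k := by rw [inv_pow]; field_simp

theorem rationallyApproximable_of_differentiable {f : ℂ → ℂ} (hf : Differentiable ℂ f)
    {K : Set ℂ} (hK : IsCompact K) : RationallyApproximable 1 f K := by
  intro C hC
  obtain ⟨B, hB⟩ := hK.isBounded.exists_norm_le
  obtain ⟨M, hM, h⟩ := (superexponentialDecay_taylor hf).exists_norm_partial_sum_sub_le B hC
  refine ⟨M, hM, fun n => ⟨∑ k ∈ Finset.range n,
    Polynomial.C ((k.factorial : ℂ)⁻¹ * iteratedDeriv k f 0) * Polynomial.X ^ k, 1, ?_,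
    by simp, by simp, fun z hz => ?_⟩⟩
  · refine Polynomial.natDegree_sum_le_of_forall_le _ _ fun k hk => ?_
    refine (Polynomial.natDegree_C_mul_X_pow_le _ _).trans ?_
    have := Finset.mem_range.1 hk
    omega
  · have hs := hasSum_taylorSeries_of_entire hf 0 z
    have := h z (f z) (hB z hz) (by
      convert! hs using 2 with k
      simp only [sub_zero, smul_eq_mul]
      ring) n
    simpa [Polynomial.eval_finsetSum] using this

theorem rationallyApproximable_principalPart {a : ℕ → ℂ} (ha : SuperexponentialDecay a)
    {s : ℂ} {K : Set ℂ} (hK : IsCompact K) (hs : s ∉ K) :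
    RationallyApproximable 1 (fun z => (z - s)⁻¹ * ∑' k, a k * (z - s)⁻¹ ^ k) K := by
  intro C hC
  have hne : ∀ z ∈ K, z - s ≠ 0 := fun z hz h => hs (sub_eq_zero.1 h ▸ hz)
  obtain ⟨B, hB⟩ := hK.exists_bound_of_continuousOn (f := fun z => (z - s)⁻¹)
    ((continuousOn_id.sub continuousOn_const).inv₀ hne)
  obtain ⟨M, hM, h⟩ := ha.exists_norm_partial_sum_sub_le B hC
  refine ⟨(|B| + 1) * M, by positivity, fun n => ⟨∑ k ∈ Finset.range n,
    Polynomial.C (a k) * (Polynomial.X - Polynomial.C s) ^ (n - 1 - k),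
    (Polynomial.X - Polynomial.C s) ^ n, ?_, ?_, ?_, fun z hz => ?_⟩⟩
  · refine Polynomial.natDegree_sum_le_of_forall_le _ _ fun k hk => ?_
    refine (Polynomial.natDegree_C_mul_le _ _).trans ?_
    rw [Polynomial.natDegree_pow, Polynomial.natDegree_X_sub_C]
    omega
  · rw [Polynomial.natDegree_pow, Polynomial.natDegree_X_sub_C]
    omega
  · intro z hz
    simpa using fun h => absurd h (hne z hz)
  · have hz0 := hne z hz
    have key := h (z - s)⁻¹ _ (hB z hz) (ha.summable _).hasSum n
    have e : (∑ k ∈ Finset.range n, Polynomial.C (a k) *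
        (Polynomial.X - Polynomial.C s) ^ (n - 1 - k)).eval z /
        ((Polynomial.X - Polynomial.C s) ^ n).eval z =
        (z - s)⁻¹ * ∑ k ∈ Finset.range n, a k * (z - s)⁻¹ ^ k := by
      rw [Polynomial.eval_finsetSum, Finset.sum_div, Finset.mul_sum]
      refine Finset.sum_congr rfl fun k hk => ?_
      have hn : n = n - 1 - k + k + 1 := by have := Finset.mem_range.1 hk; omega
      simp only [Polynomial.eval_mul, Polynomial.eval_C, Polynomial.eval_pow,
        Polynomial.eval_sub, Polynomial.eval_X]
      generalize n - 1 - k = m at hn ⊢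
      rw [hn, inv_pow, pow_add, pow_add]
      field_simp
    rw [e, ← mul_sub, norm_mul, mul_assoc]
    gcongr
    exact (hB z hz).trans ((le_abs_self B).trans (by linarith))

/-- Expansion of a Cauchy integral outside the circle of integration. -/
theorem hasSum_circleIntegral_exterior {f : ℂ → ℂ} {c z : ℂ} {r : ℝ} (hr : 0 < r)
    (hf : CircleIntegrable f c r) (hz : r < ‖z - c‖) :
    HasSum (fun k : ℕ => (z - c)⁻¹ * ((∮ w in C(c, r), (w - c) ^ k * f w) * (z - c)⁻¹ ^ k))
      (-∮ w in C(c, r), (w - z)⁻¹ * f w) := by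
  have hz0 : 0 < ‖z - c‖ := hr.trans hz
  have hzc : z - c ≠ 0 := norm_pos_iff.1 hz0
  have hq : r / ‖z - c‖ ∈ Ico (0 : ℝ) 1 := ⟨by positivity, (div_lt_one hz0).2 hz⟩
  have key : HasSum
      (fun k : ℕ => ∮ w in C(c, r), ((w - c) / (z - c)) ^ k • (z - c)⁻¹ • f w)
      (∮ w in C(c, r), (z - w)⁻¹ • f w) := by
    refine intervalIntegral.hasSum_integral_of_dominated_convergence
      (fun n θ => r * ‖z - c‖⁻¹ * ‖f (circleMap c r θ)‖ * (r / ‖z - c‖) ^ n)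
      (fun n => ?_) (fun n => ?_) ?_ ?_ ?_
    · simp only [deriv_circleMap]
      apply MeasureTheory.AEStronglyMeasurable.fun_smul
      · exact Measurable.aestronglyMeasurable (by fun_prop)
      · apply MeasureTheory.AEStronglyMeasurable.fun_smul
        · exact Measurable.aestronglyMeasurable (by fun_prop)
        · exact hf.def'.1.fun_const_smul (z - c)⁻¹
    · refine Eventually.of_forall fun θ _ => le_of_eq ?_
      simp [abs_of_pos hr]
      ring
    · exact Eventually.of_forall fun _ _ => (summable_geometric_of_lt_one hq.1 hq.2).mul_left _
    · simp only [tsum_mul_left, tsum_geometric_of_lt_one hq.1 hq.2]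
      exact (hf.norm.const_mul _).mul_continuousOn continuousOn_const
    · refine Eventually.of_forall fun θ _ => HasSum.const_smul _ ?_
      simp only [smul_smul]
      refine HasSum.smul_const ?_ _
      have : ‖(circleMap c r θ - c) / (z - c)‖ < 1 := by simpa [abs_of_pos hr] using hq.2
      convert! (hasSum_geometric_of_norm_lt_one this).mul_right _ using 1
      rw [← mul_inv, sub_mul, div_mul_cancel₀ _ hzc]
      congr 1
      ring
  convert key using 1
  · ext k
    rw [mul_comm _ ((z - c)⁻¹ ^ k), ← mul_assoc, ← circleIntegral.integral_const_mul]
    congr 1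
    ext w
    simp only [smul_eq_mul, div_pow, inv_pow]
    ring
  · rw [← neg_one_mul, ← circleIntegral.integral_const_mul]
    congr 1
    ext w
    rw [smul_eq_mul, ← neg_sub w z, inv_neg]
    ring

/-- Cauchy's integral formula on an annulus. -/
theorem circleIntegral_sub_eq_of_differentiableOn_annulus {f : ℂ → ℂ} {c z : ℂ} {r R : ℝ}
    {V : Set ℂ} (hV : IsOpen V) (hf : DifferentiableOn ℂ f V) (hr : 0 < r)
    (hsub : closedBall c R \ ball c r ⊆ V) (hrz : r < ‖z - c‖) (hzR : ‖z - c‖ < R) :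
    (∮ w in C(c, R), (w - z)⁻¹ * f w) - (∮ w in C(c, r), (w - z)⁻¹ * f w) =
      2 * Real.pi * I * f z := by
  have hrR : r < R := hrz.trans hzR
  have hR : 0 < R := hr.trans hrR
  have hzV : z ∈ V := hsub ⟨by simpa [dist_eq_norm] using hzR.le,
    by simpa [dist_eq_norm] using hrz.le⟩
  have hd : DifferentiableOn ℂ (dslope f z) V :=
    (differentiableOn_dslope (hV.mem_nhds hzV)).2 hf
  have heq := circleIntegral_eq_of_differentiable_on_annulus_off_countable hr hrR.le
    countable_empty (hd.continuousOn.mono hsub) (fun w hw => hd.differentiableAt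
      (hV.mem_nhds (hsub ⟨ball_subset_closedBall hw.1.1, fun h =>
        hw.1.2 (ball_subset_closedBall h)⟩)))
  have expand : ∀ t : ℝ, 0 < t → t ≠ ‖z - c‖ → sphere c t ⊆ V →
      (∮ w in C(c, t), dslope f z w) =
        (∮ w in C(c, t), (w - z)⁻¹ * f w) - f z * ∮ w in C(c, t), (w - z)⁻¹ := by
    intro t ht htz htV
    have hne : ∀ w ∈ sphere c t, w - z ≠ 0 := by
      intro w hw h
      rw [sub_eq_zero.1 h, mem_sphere_iff_norm] at hw
      exact htz hw.symm
    have hinv : ContinuousOn (fun w => (w - z)⁻¹) (sphere c t) :=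
      (continuousOn_id.sub continuousOn_const).inv₀ hne
    rw [← circleIntegral.integral_const_mul, ← circleIntegral.integral_sub]
    · refine circleIntegral.integral_congr ht.le fun w hw => ?_
      rw [dslope_of_ne _ (sub_ne_zero.1 (hne w hw)), slope_def_field]
      ring
    · exact (hinv.mul (hf.continuousOn.mono htV)).circleIntegrable ht.le
    · exact (continuousOn_const.mul hinv).circleIntegrable ht.le
  have hRV : sphere c R ⊆ V := fun w hw => hsub ⟨sphere_subset_closedBall hw, by
    rw [mem_sphere] at hw; simp [hw, hrR.le]⟩
  have hrV : sphere c r ⊆ V := fun w hw => hsub ⟨by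
    rw [mem_sphere] at hw; simp [hw, hrR.le], by rw [mem_sphere] at hw; simp [hw]⟩
  have h0 : (∮ w in C(c, r), (w - z)⁻¹) = 0 := by
    have hne : ∀ w ∈ closedBall c r, w - z ≠ 0 := by
      intro w hw h
      rw [sub_eq_zero.1 h, mem_closedBall, dist_eq_norm] at hw
      linarith
    refine circleIntegral_eq_zero_of_differentiable_on_off_countable hr.le countable_empty
      ((continuousOn_id.sub continuousOn_const).inv₀ hne) fun w hw => ?_
    exact (differentiableAt_id.sub_const z).inv (hne w (ball_subset_closedBall hw.1))
  rw [expand R hR hzR.ne' hRV, expand r hr hrz.ne hrV, h0,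
    circleIntegral.integral_sub_inv_of_mem_ball (by simpa [dist_eq_norm] using hzR)] at heq
  linear_combination heq

/-- Splitting off the principal part at an isolated singularity. -/
theorem exists_principalPart {f : ℂ → ℂ} {s : ℂ} {U : Set ℂ} (hU : IsOpen U) (hs : s ∈ U)
    (hf : DifferentiableOn ℂ f (U \ {s})) :
    ∃ (a : ℕ → ℂ) (g : ℂ → ℂ), SuperexponentialDecay a ∧ DifferentiableOn ℂ g U ∧
      ∀ z, z ≠ s → f z = g z + (z - s)⁻¹ * ∑' k, a k * (z - s)⁻¹ ^ k := by
  obtain ⟨R, hR, hRU⟩ := nhds_basis_closedBall.mem_iff.1 (hU.mem_nhds hs)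
  have hV : IsOpen (U \ {s}) := hU.sdiff isClosed_singleton
  have hpi : (2 * Real.pi * I : ℂ) ≠ 0 := two_pi_I_ne_zero
  have hann : ∀ r, 0 < r → closedBall s R \ ball s r ⊆ U \ {s} := fun r hr w hw =>
    ⟨hRU hw.1, fun h => hw.2 (by rw [mem_singleton_iff.1 h]; exact mem_ball_self hr)⟩
  have hsph : ∀ r, 0 < r → r ≤ R → sphere s r ⊆ U \ {s} := fun r hr hrR w hw =>
    hann r hr ⟨by rw [mem_sphere] at hw; simp [hw, hrR], by rw [mem_sphere] at hw; simp [hw]⟩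
  set a : ℕ → ℂ := fun k => (2 * Real.pi * I)⁻¹ * ∮ w in C(s, R), (w - s) ^ k * f w with ha_def
  have ha_eq : ∀ r, 0 < r → r ≤ R → ∀ k,
      a k = (2 * Real.pi * I)⁻¹ * ∮ w in C(s, r), (w - s) ^ k * f w := by
    intro r hr hrR k
    have hd : DifferentiableOn ℂ (fun w => (w - s) ^ k * f w) (U \ {s}) :=
      DifferentiableOn.mul (by fun_prop) hf
    rw [ha_def]
    simp only
    rw [circleIntegral_eq_of_differentiable_on_annulus_off_countable hr hrR
      countable_empty (hd.continuousOn.mono (hann r hr)) (fun w hw => hd.differentiableAt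
      (hV.mem_nhds (hann r hr ⟨ball_subset_closedBall hw.1.1, fun h =>
        hw.1.2 (ball_subset_closedBall h)⟩)))]
  have ha : SuperexponentialDecay a := by
    intro ρ hρ
    obtain ⟨r, hr, hrR, hrρ⟩ : ∃ r, 0 < r ∧ r ≤ R ∧ r ≤ ρ :=
      ⟨min R ρ, lt_min hR hρ, min_le_left _ _, min_le_right _ _⟩
    obtain ⟨M, hM⟩ := (isCompact_sphere s r).exists_bound_of_continuousOn
      (hf.continuousOn.mono (hsph r hr hrR))
    have hM0 : 0 ≤ M := (norm_nonneg _).trans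
      (hM (s + r) (by simp [abs_of_pos hr]))
    refine ⟨r * M, fun k => ?_⟩
    rw [ha_eq r hr hrR, ← smul_eq_mul]
    refine (circleIntegral.norm_two_pi_i_inv_smul_integral_le_of_norm_le_const
      (C := r ^ k * M) hr.le fun w hw => ?_).trans ?_
    · rw [norm_mul, norm_pow, mem_sphere_iff_norm.1 hw]
      gcongr
      exact hM w hw
    · calc r * (r ^ k * M) = r * M * r ^ k := by ring
        _ ≤ r * M * ρ ^ k := by gcongr
  set P : ℂ → ℂ := fun z => (z - s)⁻¹ * ∑' k, a k * (z - s)⁻¹ ^ k with hP_def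
  have hP : DifferentiableOn ℂ P (U \ {s}) := by
    have hinv : DifferentiableOn ℂ (fun z => (z - s)⁻¹) (U \ {s}) :=
      DifferentiableOn.inv (by fun_prop) fun z hz => sub_ne_zero.2 hz.2
    exact hinv.mul (ha.differentiable_tsum.comp_differentiableOn hinv)
  have hreg : ∀ z, z ≠ s → ‖z - s‖ < R →
      f z - P z = (2 * Real.pi * I : ℂ)⁻¹ • ∮ w in C(s, R), (w - z)⁻¹ * f w := by
    intro z hzs hzR
    have hz0 : 0 < ‖z - s‖ := norm_pos_iff.2 (sub_ne_zero.2 hzs)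
    obtain ⟨r, hr, hrz⟩ := exists_between hz0
    have hrR : r ≤ R := (hrz.trans hzR).le
    have hC := circleIntegral_sub_eq_of_differentiableOn_annulus hV hf hr (hann r hr) hrz hzR
    have hE := (hasSum_circleIntegral_exterior hr
      ((hf.continuousOn.mono (hsph r hr hrR)).circleIntegrable hr.le) hrz).mul_left
        (2 * Real.pi * I : ℂ)⁻¹
    have hPz : P z = (2 * Real.pi * I : ℂ)⁻¹ * -∮ w in C(s, r), (w - z)⁻¹ * f w := by
      rw [← hE.tsum_eq, hP_def]
      simp only
      rw [← tsum_mul_left]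
      refine tsum_congr fun k => ?_
      rw [ha_eq r hr hrR]
      ring
    rw [hPz, smul_eq_mul, sub_eq_iff_eq_add, ← mul_add, ← sub_eq_add_neg, hC,
      inv_mul_cancel_left₀ hpi]
  have hg0 : DifferentiableOn ℂ (fun z => f z - P z) (U \ {s}) := hf.sub hP
  obtain ⟨M, hM⟩ := (isCompact_sphere s R).exists_bound_of_continuousOn
    (hf.continuousOn.mono (hsph R hR le_rfl))
  have hbdd : BddAbove (norm ∘ (fun z => f z - P z) '' (ball s (R / 2) \ {s})) := by
    refine ⟨R * ((R / 2)⁻¹ * M), ?_⟩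
    rintro _ ⟨z, ⟨hz, hzs⟩, rfl⟩
    have hz' : ‖z - s‖ < R / 2 := by simpa [dist_eq_norm] using hz
    rw [Function.comp_apply, hreg z hzs (by linarith)]
    refine circleIntegral.norm_two_pi_i_inv_smul_integral_le_of_norm_le_const hR.le
      fun w hw => ?_
    have hwz : R / 2 ≤ ‖w - z‖ := by
      have := norm_sub_norm_le (w - s) (z - s)
      rw [mem_sphere_iff_norm.1 hw, sub_sub_sub_cancel_right] at this
      linarith
    rw [norm_mul, norm_inv]
    gcongr
    exact hM w hw
  have hsub : ball s (R / 2) ⊆ U := (ball_subset_closedBall.trans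
    (closedBall_subset_closedBall (by linarith))).trans hRU
  have hball : ball s (R / 2) ∈ 𝓝 s := ball_mem_nhds s (by positivity)
  have hupd := differentiableOn_update_limUnder_of_bddAbove hball
    (hg0.mono (sdiff_subset_sdiff_left hsub)) hbdd
  refine ⟨a, _, ha, (differentiableOn_compl_singleton_and_continuousAt_iff
    (hU.mem_nhds hs)).1 ⟨hg0.congr fun z hz => ?_, (hupd.differentiableAt hball).continuousAt⟩,
    fun z hz => ?_⟩
  · exact Function.update_of_ne hz.2 _ _
  · rw [Function.update_of_ne hz]
    simp only [hP_def]
    ring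

theorem exists_rationallyApproximable {S : Set ℂ} (hS : S.Finite) {K : Set ℂ}
    (hK : IsCompact K) (hKS : Disjoint K S) :
    ∃ N, 0 < N ∧ ∀ f : ℂ → ℂ, DifferentiableOn ℂ f Sᶜ → RationallyApproximable N f K := by
  induction S, hS using Set.Finite.induction_on with
  | empty =>
    refine ⟨1, one_pos, fun f hf => rationallyApproximable_of_differentiable ?_ hK⟩
    rwa [compl_empty, differentiableOn_univ] at hf
  | @insert s T hsT hT ih =>
    rw [disjoint_insert_right] at hKS
    obtain ⟨N, hN, h⟩ := ih hKS.2
    refine ⟨N + 1, N.succ_pos, fun f hf => ?_⟩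
    obtain ⟨a, g, ha, hg, hfg⟩ := exists_principalPart (f := f) hT.isClosed.isOpen_compl hsT
      (hf.mono fun z hz h => h.elim hz.2 hz.1)
    exact (h g hg).add (rationallyApproximable_principalPart ha hK hKS.1) fun z hz =>
      hfg z fun h => hKS.1 (h ▸ hz)

/-- Rational minimax errors decrease superexponentially for functions holomorphic
off a finite set (even when the isolated singularities are essential). -/
theorem holomorphic_off_finite_set_superexponential_rational_approx
    (S : Set ℂ) (hS : S.Finite) (f : ℂ → ℂ) (hf : DifferentiableOn ℂ f Sᶜ)
    (K : Set ℂ) (hK : IsCompact K) (hKS : K ∩ S = ∅) :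
    ∀ C : ℝ, 1 < C → ∃ M : ℝ, 0 < M ∧ ∀ n : ℕ,
      ∃ p q : Polynomial ℂ, p.natDegree ≤ n ∧ q.natDegree ≤ n ∧
        (∀ z ∈ K, q.eval z ≠ 0) ∧
        ∀ z ∈ K, ‖f z - p.eval z / q.eval z‖ ≤ M * C ^ (-(n : ℤ)) := by
  intro C hC
  obtain ⟨N, hN, h⟩ := exists_rationallyApproximable hS hK (disjoint_iff_inter_eq_empty.2 hKS)
  obtain ⟨M, hM, happ⟩ := h f hf (C ^ N) (one_lt_pow₀ hC hN.ne')
  have hC0 : 0 < C := by linarith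
  refine ⟨M * C ^ N, by positivity, fun n => ?_⟩
  obtain ⟨p, q, hp, hq, hz, he⟩ := happ (n / N)
  have hdeg : N * (n / N) ≤ n := Nat.mul_div_le n N
  refine ⟨p, q, hp.trans hdeg, hq.trans hdeg, hz, fun z hzK => (he z hzK).trans ?_⟩
  rw [zpow_neg, zpow_natCast, mul_assoc]
  gcongr
  rw [← pow_mul, ← div_eq_mul_inv, le_div_iff₀ (by positivity),
    inv_mul_le_iff₀ (by positivity), ← pow_add]
  refine pow_le_pow_right₀ hC.le ?_
  have := Nat.lt_mul_div_succ n hN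
  rw [mul_add] at this
  omega
end

section
/- (Newman's upper bound) For every natural number n ≥ 4 there exist real polynomials p and q, each of degree at most n, such that q(x) ≠ 0 for all x ∈ [−1, 1] and sup_{x ∈ [−1,1]} | |x| − p(x)/q(x) | ≤ 3 · exp(−√n). (Rational functions approximate |x| on [−1,1] with root-exponential accuracy.) -/
open Polynomial

/-- The function `t ↦ (1 - t) / (1 + t)` is bounded by `exp (-2 t)` on `[0, 1]`. -/
theorem one_sub_le_exp_mul_one_add {t : ℝ} (h0 : 0 ≤ t) (h1 : t ≤ 1) :
    1 - t ≤ Real.exp (-2 * t) * (1 + t) := by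
  rcases h1.eq_or_lt with rfl | h1
  · norm_num
    positivity
  have hs := Real.hasSum_log_sub_log_of_abs_lt_one (x := t) (by rwa [abs_of_nonneg h0])
  have hlog : 2 * t ≤ Real.log (1 + t) - Real.log (1 - t) := by
    have := le_hasSum hs 0 (fun j _ => by positivity)
    simpa using this
  calc 1 - t = Real.exp (Real.log (1 - t)) := (Real.exp_log (by linarith)).symm
    _ ≤ Real.exp (-2 * t + Real.log (1 + t)) := Real.exp_le_exp.2 (by linarith)
    _ = Real.exp (-2 * t) * (1 + t) := by rw [Real.exp_add, Real.exp_log (by linarith)]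

theorem abs_sub_le_exp_mul_add {x a s : ℝ} (hx : 0 < x) (ha : 0 < a) (hsx : s * x ≤ a)
    (hsa : s * a ≤ x) : |x - a| ≤ Real.exp (-2 * s) * (x + a) := by
  wlog hxa : x ≤ a generalizing x a
  · rw [abs_sub_comm, add_comm]
    exact this ha hx hsa hsx (le_of_not_ge hxa)
  have hst : s ≤ x / a := (le_div_iff₀ ha).2 hsa
  have ht := one_sub_le_exp_mul_one_add (t := x / a) (by positivity) ((div_le_one ha).2 hxa)
  calc |x - a| = (1 - x / a) * a := by
        rw [abs_sub_comm, abs_of_nonneg (by linarith)]; field_simp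
    _ ≤ Real.exp (-2 * (x / a)) * (1 + x / a) * a := by gcongr
    _ = Real.exp (-2 * (x / a)) * (x + a) := by field_simp; ring
    _ ≤ Real.exp (-2 * s) * (x + a) := by
        gcongr ?_ * _
        exact Real.exp_le_exp.2 (by linarith)

/-- Decay of Newman's product with nodes `1, ξ, …, ξ ^ (m - 1)` on `[ξ ^ m, 1]`. -/
theorem abs_prod_sub_pow_le {ξ : ℝ} (h0 : 0 < ξ) (h1 : ξ ≤ 1) (m : ℕ) {x : ℝ}
    (hx : ξ ^ m ≤ x) (hx1 : x ≤ 1) :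
    |∏ k ∈ Finset.range m, (x - ξ ^ k)| ≤
      Real.exp (-2 * ∑ i ∈ Finset.range m, ξ ^ (i + 1)) *
        ∏ k ∈ Finset.range m, (x + ξ ^ k) := by
  induction m with
  | zero => simp
  | succ m ih =>
    have hxpos : 0 < x := lt_of_lt_of_le (by positivity) hx
    rcases le_or_gt (ξ ^ m) x with hmx | hmx
    · have hlast : |x - ξ ^ m| ≤ Real.exp (-2 * ξ ^ (m + 1)) * (x + ξ ^ m) := by
        apply abs_sub_le_exp_mul_add hxpos (by positivity)
        · calc ξ ^ (m + 1) * x ≤ ξ ^ (m + 1) * 1 := by gcongr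
            _ ≤ ξ ^ m := by
              rw [mul_one]; exact pow_le_pow_of_le_one h0.le h1 (Nat.le_succ m)
        · calc ξ ^ (m + 1) * ξ ^ m ≤ ξ ^ (m + 1) * 1 := by
                gcongr; exact pow_le_one₀ h0.le h1
            _ ≤ x := by rwa [mul_one]
      rw [Finset.prod_range_succ, Finset.prod_range_succ, Finset.sum_range_succ, abs_mul, mul_add,
        Real.exp_add]
      calc _ ≤ _ := mul_le_mul (ih hmx) hlast (abs_nonneg _) (by positivity)
        _ = _ := by ring
    · rw [← Finset.sum_range_reflect, Finset.mul_sum, Real.exp_sum, ← Finset.prod_mul_distrib,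
        Finset.abs_prod]
      refine Finset.prod_le_prod (fun _ _ => abs_nonneg _) fun k hk => ?_
      have hk : k ≤ m := Nat.lt_succ_iff.1 (Finset.mem_range.1 hk)
      apply abs_sub_le_exp_mul_add hxpos (by positivity)
      · have hxk : x ≤ ξ ^ k := hmx.le.trans (pow_le_pow_of_le_one h0.le h1 hk)
        calc ξ ^ (m + 1 - 1 - k + 1) * x ≤ 1 * x := by
              gcongr; exact pow_le_one₀ h0.le h1
          _ ≤ ξ ^ k := by rwa [one_mul]
      · rw [← pow_add]
        convert hx using 2
        omega

/-- Lower bound for the geometric sum governing the decay of Newman's product. -/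
theorem sqrt_add_one_le_two_mul_geom_sum {m : ℕ} (hm : 4 ≤ m) :
    √((m : ℝ) + 1) ≤ 2 * ∑ i ∈ Finset.range m, Real.exp (-(1 / √(m : ℝ))) ^ (i + 1) := by
  have hm' : (4 : ℝ) ≤ m := by exact_mod_cast hm
  set s := √(m : ℝ) with hs
  have hs2 : 2 ≤ s := Real.le_sqrt_of_sq_le (by linarith)
  have hss : s ^ 2 = m := Real.sq_sqrt (by linarith)
  set h := 1 / s with hh
  have hhs : h * s = 1 := by rw [hh]; field_simp
  have hh0 : 0 < h := by positivity
  have hh1 : h ≤ 1 / 2 := by rw [hh]; gcongr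
  set ξ := Real.exp (-h) with hξ
  have hξm : ξ ^ m ≤ 0.16 := by
    have hpow : ξ ^ m = Real.exp (-s) := by
      rw [hξ, ← Real.exp_nat_mul, ← hss]
      congr 1
      linear_combination -s * hhs
    have he : (2.5 : ℝ) ^ 2 ≤ Real.exp 2 := by
      have : Real.exp 2 = Real.exp 1 ^ 2 := by rw [← Real.exp_nat_mul]; norm_num
      rw [this]
      have := Real.exp_one_gt_d9
      gcongr
      linarith
    calc ξ ^ m = Real.exp (-s) := hpow
      _ ≤ Real.exp (-2) := Real.exp_le_exp.2 (by linarith)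
      _ = (Real.exp 2)⁻¹ := Real.exp_neg 2
      _ ≤ ((2.5 : ℝ) ^ 2)⁻¹ := by gcongr
      _ = 0.16 := by norm_num
  have hexp : Real.exp h - 1 ≤ h + h ^ 2 := by
    have := (abs_le.1 (Real.abs_exp_sub_one_sub_id_le (x := h)
      (by rw [abs_of_pos hh0]; linarith))).2
    linarith
  have hξe : ξ * Real.exp h = 1 := by rw [hξ, ← Real.exp_add]; simp
  have hsum : ∑ i ∈ Finset.range m, ξ ^ (i + 1) = ξ * ∑ i ∈ Finset.range m, ξ ^ i := by
    rw [Finset.mul_sum]; exact Finset.sum_congr rfl fun i _ => pow_succ' _ _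
  have hS0 : 0 ≤ ∑ i ∈ Finset.range m, ξ ^ (i + 1) := by positivity
  have hgeom : (∑ i ∈ Finset.range m, ξ ^ (i + 1)) * (Real.exp h - 1) = 1 - ξ ^ m := by
    rw [hsum]
    linear_combination (∑ i ∈ Finset.range m, ξ ^ i) * hξe - geom_sum_mul ξ m
  set S := ∑ i ∈ Finset.range m, ξ ^ (i + 1)
  have hS : 1.68 ≤ 2 * S * (h + h ^ 2) := by
    have := mul_le_mul_of_nonneg_left hexp hS0
    linarith
  have hroot : √((m : ℝ) + 1) * (h + h ^ 2) ≤ 1.68 := by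
    apply le_of_sq_le_sq _ (by norm_num)
    rw [mul_pow, Real.sq_sqrt (by positivity)]
    have hmh : (m : ℝ) * h ^ 2 = 1 := by
      rw [← hss]; linear_combination (h * s + 1) * hhs
    calc ((m : ℝ) + 1) * (h + h ^ 2) ^ 2 = (1 + h ^ 2) * (1 + h) ^ 2 := by
          linear_combination (1 + h) ^ 2 * hmh
      _ ≤ (1 + (1 / 2) ^ 2) * (1 + 1 / 2) ^ 2 := by gcongr
      _ ≤ 1.68 ^ 2 := by norm_num
  exact le_of_mul_le_mul_right (hroot.trans hS) (by positivity)

theorem abs_sub_mul_div_le_self {x a b : ℝ} (hx : 0 ≤ x) (ha : 0 < a) (hb : 0 ≤ b)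
    (hba : b ≤ a) : |x - x * (a - b) / (a + b)| ≤ x := by
  have hab : 0 < a + b := by linarith
  have heq : x - x * (a - b) / (a + b) = x * (2 * b / (a + b)) := by field_simp; ring
  rw [heq, abs_of_nonneg (by positivity)]
  exact mul_le_of_le_one_right hx ((div_le_one hab).2 (by linarith))

theorem abs_sub_mul_div_le_three_mul {x a b ε : ℝ} (hx : 0 ≤ x) (hx1 : x ≤ 1) (ha : 0 < a)
    (hε : ε ≤ 1 / 3) (hba : |b| ≤ ε * a) : |x - x * (a - b) / (a + b)| ≤ 3 * ε := by
  have hb := abs_le.1 hba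
  have hεa : ε * a ≤ 1 / 3 * a := by gcongr
  have hab : 2 / 3 * a ≤ a + b := by linarith
  have hab0 : 0 < a + b := by linarith
  have heq : x - x * (a - b) / (a + b) = x * (2 * b / (a + b)) := by field_simp; ring
  have hε0 : 0 ≤ ε := nonneg_of_mul_nonneg_left ((abs_nonneg b).trans hba) ha
  rw [heq, abs_mul, abs_of_nonneg hx, abs_div, abs_of_pos hab0, abs_mul, abs_two]
  refine (mul_le_of_le_one_left (by positivity) hx1).trans ?_
  rw [div_le_iff₀ hab0]
  have := mul_le_mul_of_nonneg_left hab hε0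
  linarith

/-- Newman's upper bound: rational functions of degree `n ≥ 4` approximate `|x|`
on `[-1, 1]` with root-exponential accuracy `3 e^{-√n}`. -/
theorem newman_upper_bound (n : ℕ) (hn : 4 ≤ n) :
    ∃ p q : Polynomial ℝ, p.natDegree ≤ n ∧ q.natDegree ≤ n ∧
      (∀ x ∈ Set.Icc (-1 : ℝ) 1, q.eval x ≠ 0) ∧
      ∀ x ∈ Set.Icc (-1 : ℝ) 1,
        |(|x| - p.eval x / q.eval x)| ≤ 3 * Real.exp (-Real.sqrt n) := by
  obtain ⟨m, hmeven, hm4, hmn, hnm⟩ : ∃ m, Even m ∧ 4 ≤ m ∧ m ≤ n ∧ n ≤ m + 1 :=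
    ⟨2 * (n / 2), even_two_mul _, by omega, by omega, by omega⟩
  have hsqrt : √(n : ℝ) ≤ √((m : ℝ) + 1) := Real.sqrt_le_sqrt (by exact_mod_cast hnm)
  set ξ := Real.exp (-(1 / √(m : ℝ))) with hξ
  have hξ0 : 0 < ξ := Real.exp_pos _
  have hξ1 : ξ ≤ 1 := Real.exp_le_one_iff.2 (by simp)
  set ε := Real.exp (-√(n : ℝ)) with hε
  have hε3 : ε ≤ 1 / 3 := by
    have h2 : (2 : ℝ) ≤ √(n : ℝ) := Real.le_sqrt_of_sq_le (by norm_num; exact_mod_cast hn)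
    rw [hε, Real.exp_neg, one_div]
    gcongr
    linarith [Real.add_one_le_exp √(n : ℝ)]
  have hξm : ξ ^ m ≤ 3 * ε := by
    have hm0 : (0 : ℝ) < m := by exact_mod_cast (by omega : 0 < m)
    have hpow : ξ ^ m = Real.exp (-√(m : ℝ)) := by
      rw [hξ, ← Real.exp_nat_mul]
      congr 1
      rw [mul_neg, mul_one_div, Real.div_sqrt]
    have hroot : √((m : ℝ) + 1) ≤ √(m : ℝ) + 1 := by
      rw [Real.sqrt_le_left (by positivity), add_sq, Real.sq_sqrt hm0.le]
      nlinarith [Real.sqrt_nonneg (m : ℝ)]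
    calc ξ ^ m ≤ Real.exp (1 + -√(n : ℝ)) := by
          rw [hpow]; exact Real.exp_le_exp.2 (by linarith)
      _ = Real.exp 1 * ε := Real.exp_add _ _
      _ ≤ 3 * ε := by gcongr; linarith [Real.exp_one_lt_d9]
  set A : ℝ → ℝ := fun x => ∏ k ∈ Finset.range m, (x + ξ ^ k) with hA
  set B : ℝ → ℝ := fun x => ∏ k ∈ Finset.range m, (x - ξ ^ k) with hB
  have hAneg : ∀ x, A (-x) = B x := fun x => by
    simp only [hA, hB]
    rw [← Finset.prod_congr rfl fun k _ => show -(x - ξ ^ k) = -x + ξ ^ k by ring,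
      Finset.prod_neg, Finset.card_range, hmeven.neg_one_pow, one_mul]
  have hBneg : ∀ x, B (-x) = A x := fun x => by rw [← hAneg, neg_neg]
  have hApos : ∀ x, 0 ≤ x → 0 < A x := fun x hx => Finset.prod_pos fun k _ => by positivity
  have hsmall : ∀ x, 0 ≤ x → x ≤ ξ ^ m → 0 ≤ B x ∧ B x ≤ A x := fun x hx hxm => by
    have hxk : ∀ k ∈ Finset.range m, x ≤ ξ ^ k := fun k hk =>
      hxm.trans (pow_le_pow_of_le_one hξ0.le hξ1 (Finset.mem_range.1 hk).le)
    rw [← hAneg]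
    refine ⟨Finset.prod_nonneg fun k hk => ?_, Finset.prod_le_prod (fun k hk => ?_) fun k hk => ?_⟩
      <;> linarith [hxk k hk]
  have hlarge : ∀ x, ξ ^ m ≤ x → x ≤ 1 → |B x| ≤ ε * A x := fun x hx hx1 => by
    refine (abs_prod_sub_pow_le hξ0 hξ1 m hx hx1).trans ?_
    refine mul_le_mul_of_nonneg_right (Real.exp_le_exp.2 ?_)
      (hApos x ((pow_pos hξ0 m).le.trans hx)).le
    linarith [sqrt_add_one_le_two_mul_geom_sum hm4]
  have hpos : ∀ x, 0 ≤ x → x ≤ 1 → 0 < A x + B x := fun x hx hx1 => by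
    have := hApos x hx
    rcases le_total x (ξ ^ m) with h | h
    · linarith [(hsmall x hx h).1]
    · have := (abs_le.1 (hlarge x h hx1)).1
      nlinarith
  have herr : ∀ x, 0 ≤ x → x ≤ 1 → |x - x * (A x - B x) / (A x + B x)| ≤ 3 * ε :=
    fun x hx hx1 => by
      rcases le_total x (ξ ^ m) with h | h
      · have := hsmall x hx h
        exact (abs_sub_mul_div_le_self hx (hApos x hx) this.1 this.2).trans (h.trans hξm)
      · exact abs_sub_mul_div_le_three_mul hx hx1 (hApos x hx) hε3 (hlarge x h hx1)
  let P : Polynomial ℝ := ∏ k ∈ Finset.range m, (X + C (ξ ^ k))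
  let Q : Polynomial ℝ := ∏ k ∈ Finset.range m, (X - C (ξ ^ k))
  have hP : P.Monic := monic_prod_of_monic _ _ fun k _ => monic_X_add_C _
  have hQ : Q.Monic := monic_prod_of_monic _ _ fun k _ => monic_X_sub_C _
  have hPdeg : P.natDegree = m := by
    rw [natDegree_prod_of_monic _ _ fun k _ => monic_X_add_C _]; simp [-map_pow]
  have hQdeg : Q.natDegree = m := by
    rw [natDegree_prod_of_monic _ _ fun k _ => monic_X_sub_C _]; simp [-map_pow]
  have hPeval : ∀ x, P.eval x = A x := fun x => by simp [P, hA, eval_prod]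
  have hQeval : ∀ x, Q.eval x = B x := fun x => by simp [Q, hB, eval_prod]
  have hsub : (P - Q).natDegree < m :=
    IsMonicOfDegree.natDegree_sub_lt (by omega) ⟨hPdeg, hP⟩ ⟨hQdeg, hQ⟩
  refine ⟨X * (P - Q), P + Q, ?_, ?_, fun x hx => ?_, fun x hx => ?_⟩
  · have := natDegree_mul_le (p := (X : Polynomial ℝ)) (q := P - Q)
    rw [natDegree_X] at this
    omega
  · have := natDegree_add_le P Q
    rw [hPdeg, hQdeg, max_self] at this
    omega
  · rw [eval_add, hPeval, hQeval]
    rcases le_total 0 x with h | h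
    · exact (hpos x h hx.2).ne'
    · have := hpos (-x) (by linarith) (by linarith [hx.1])
      rw [hAneg, hBneg, add_comm] at this
      exact this.ne'
  · rw [eval_mul, eval_X, eval_add, eval_sub, hPeval, hQeval]
    rcases le_total 0 x with h | h
    · rw [abs_of_nonneg h]
      exact herr x h hx.2
    · rw [abs_of_nonpos h]
      have := herr (-x) (by linarith) (by linarith [hx.1])
      rw [hAneg, hBneg] at this
      convert this using 4
      · ring
      · ring
end

section
/- (Newman's lower bound) For every natural number n ≥ 4 and for all real polynomials p and q each of degree at most n with q(x) ≠ 0 for all x ∈ [−1, 1], one has sup_{x ∈ [−1,1]} | |x| − p(x)/q(x) | ≥ (1/2) · exp(−9√n). (No rational function of degree n approximates |x| on [−1,1] better than root-exponentially.) -/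
open Real Set MeasureTheory Polynomial

/-- The logarithm of `‖(x - a) / (x + a)‖`. -/
noncomputable def logReflect (a : ℂ) (x : ℝ) : ℝ :=
  log ‖(x : ℂ) - a‖ - log ‖(x : ℂ) + a‖

theorem logReflect_neg (a : ℂ) (x : ℝ) : logReflect (-a) x = -logReflect a x := by
  simp [logReflect, ← sub_eq_add_neg]

theorem neg_three_mul_div_sqrt_le_log_sub_log {w : ℝ} (h0 : 0 < w) (h1 : w < 1) :
    -(3 * w / √(1 - w)) ≤ log (1 - w) - log (1 + w) := by
  set t := √(1 - w) with ht
  have htsq : t ^ 2 = 1 - w := Real.sq_sqrt (by linarith)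
  have ht0 : 0 < t := Real.sqrt_pos.mpr (by linarith)
  have ht1 : t ≤ 1 := by nlinarith
  have hlog_add : log (1 + w) ≤ w := by
    linarith [Real.log_le_sub_one_of_pos (show 0 < 1 + w by linarith)]
  have hlog_sub : 2 * (1 - t⁻¹) ≤ log (1 - w) := by
    rw [← htsq, Real.log_pow]
    push_cast
    linarith [Real.one_sub_inv_le_log_of_pos ht0]
  have hmain : w + 2 * (t⁻¹ - 1) ≤ 3 * w / t := by
    rw [le_div_iff₀ ht0]
    have : (w + 2 * (t⁻¹ - 1)) * t = w * t + 2 * (1 - t) := by field_simp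
    rw [this]
    nlinarith [mul_nonneg ht0.le (sub_nonneg.mpr ht1)]
  linarith

theorem neg_three_mul_div_sqrt_le_log_sub_log_of_lt {y m : ℝ} (hy : 0 < y) (hym : y < m) :
    -(3 * (y / m) / √(1 - y / m)) ≤ log (m - y) - log (m + y) := by
  have hm : 0 < m := hy.trans hym
  have hw : y / m < 1 := (div_lt_one hm).mpr hym
  have hw0 : 0 < y / m := div_pos hy hm
  have h := neg_three_mul_div_sqrt_le_log_sub_log hw0 hw
  have e1 : m - y = m * (1 - y / m) := by field_simp
  have e2 : m + y = m * (1 + y / m) := by field_simp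
  rw [e1, e2, Real.log_mul hm.ne' (by linarith), Real.log_mul hm.ne' (by linarith)]
  linarith

theorem log_abs_sub_norm_le_logReflect {a : ℂ} {x : ℝ} (hx : 0 < x) (hne : x ≠ ‖a‖) :
    log |x - ‖a‖| - log (x + ‖a‖) ≤ logReflect a x := by
  have hpos : 0 < |x - ‖a‖| := abs_pos.mpr (sub_ne_zero.mpr hne)
  have h1 : |x - ‖a‖| ≤ ‖(x : ℂ) - a‖ := by
    simpa [abs_of_pos hx] using abs_norm_sub_norm_le (x : ℂ) a
  have h2 : |x - ‖a‖| ≤ ‖(x : ℂ) + a‖ := by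
    simpa [abs_of_pos hx] using abs_norm_sub_norm_le (x : ℂ) (-a)
  have h3 : ‖(x : ℂ) + a‖ ≤ x + ‖a‖ := by
    simpa [abs_of_pos hx] using norm_add_le (x : ℂ) a
  exact sub_le_sub (Real.log_le_log hpos h1) (Real.log_le_log (hpos.trans_le h2) h3)

theorem intervalIntegrable_logReflect_exp (a : ℂ) (A B : ℝ) :
    IntervalIntegrable (fun s => logReflect a (exp s)) volume A B := by
  have key (b : ℂ) : IntervalIntegrable (fun s : ℝ => log ‖((exp s : ℝ) : ℂ) + b‖) volume A B := by
    apply MeromorphicOn.intervalIntegrable_log_norm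
    intro s _
    apply AnalyticAt.meromorphicAt
    apply AnalyticAt.add _ analyticAt_const
    exact (Complex.ofRealCLM.analyticAt _).comp (analyticAt_rexp)
  simpa [logReflect, sub_eq_add_neg] using (key (-a)).sub (key a)

theorem neg_six_le_integral_logReflect_of_le {a : ℂ} {A B c : ℝ} (hAB : A ≤ B) (hc : c ≤ A)
    (ha : ‖a‖ = exp c) : -6 ≤ ∫ s in A..B, logReflect a (exp s) := by
  have hint := (intervalIntegrable_iff_integrableOn_Icc_of_le hAB).mp
    (intervalIntegrable_logReflect_exp a A B)
  have h := intervalIntegral.sub_le_integral_of_hasDeriv_right_of_le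
    (g := fun s => -6 * √(1 - exp (c - s)))
    (g' := fun s => -(3 * exp (c - s) / √(1 - exp (c - s)))) hAB
    (by fun_prop) ?_ hint ?_
  · have h1 : √(1 - exp (c - B)) ≤ 1 := Real.sqrt_le_one.mpr (by linarith [exp_pos (c - B)])
    have h2 := Real.sqrt_nonneg (1 - exp (c - A))
    linarith
  · intro s hs
    have hw : 0 < 1 - exp (c - s) := by
      have : exp (c - s) < 1 := Real.exp_lt_one_iff.mpr (by linarith [hs.1])
      linarith
    have hd : HasDerivAt (fun s => 1 - exp (c - s)) (exp (c - s)) s := by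
      simpa using (((hasDerivAt_id s).const_sub c).exp).const_sub 1
    exact (((hd.sqrt hw.ne').const_mul (-6)).congr_deriv (by ring)).hasDerivWithinAt
  · intro s hs
    have hlt : exp c < exp s := exp_lt_exp.mpr (by linarith [hs.1])
    have h1 := log_abs_sub_norm_le_logReflect (a := a) (exp_pos s) (by rw [ha]; exact hlt.ne')
    have h2 := neg_three_mul_div_sqrt_le_log_sub_log_of_lt (exp_pos c) hlt
    rw [ha, abs_of_pos (by linarith)] at h1
    rw [← exp_sub] at h2
    linarith

theorem neg_six_le_integral_logReflect_of_ge {a : ℂ} {A B c : ℝ} (hAB : A ≤ B) (hc : B ≤ c)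
    (ha : ‖a‖ = exp c) : -6 ≤ ∫ s in A..B, logReflect a (exp s) := by
  have hint := (intervalIntegrable_iff_integrableOn_Icc_of_le hAB).mp
    (intervalIntegrable_logReflect_exp a A B)
  have h := intervalIntegral.sub_le_integral_of_hasDeriv_right_of_le
    (g := fun s => 6 * √(1 - exp (s - c)))
    (g' := fun s => -(3 * exp (s - c) / √(1 - exp (s - c)))) hAB
    (by fun_prop) ?_ hint ?_
  · have h1 : √(1 - exp (A - c)) ≤ 1 := Real.sqrt_le_one.mpr (by linarith [exp_pos (A - c)])
    have h2 := Real.sqrt_nonneg (1 - exp (B - c))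
    linarith
  · intro s hs
    have hw : 0 < 1 - exp (s - c) := by
      have : exp (s - c) < 1 := Real.exp_lt_one_iff.mpr (by linarith [hs.2])
      linarith
    have hd : HasDerivAt (fun s => 1 - exp (s - c)) (-exp (s - c)) s := by
      simpa using (((hasDerivAt_id s).sub_const c).exp).const_sub 1
    exact (((hd.sqrt hw.ne').const_mul 6).congr_deriv (by ring)).hasDerivWithinAt
  · intro s hs
    have hlt : exp s < exp c := exp_lt_exp.mpr (by linarith [hs.2])
    have h1 := log_abs_sub_norm_le_logReflect (a := a) (exp_pos s) (by rw [ha]; exact hlt.ne)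
    have h2 := neg_three_mul_div_sqrt_le_log_sub_log_of_lt (exp_pos s) hlt
    rw [ha, abs_sub_comm, abs_of_pos (by linarith), add_comm] at h1
    rw [← exp_sub] at h2
    linarith

theorem neg_twelve_le_integral_logReflect (a : ℂ) {A B : ℝ} (hAB : A ≤ B) :
    -12 ≤ ∫ s in A..B, logReflect a (exp s) := by
  rcases eq_or_ne a 0 with rfl | ha
  · simp [logReflect]
  have hc : ‖a‖ = exp (log ‖a‖) := (exp_log (norm_pos_iff.mpr ha)).symm
  rcases le_total (log ‖a‖) A with h | hA
  · linarith [neg_six_le_integral_logReflect_of_le hAB h hc]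
  rcases le_total B (log ‖a‖) with h | hB
  · linarith [neg_six_le_integral_logReflect_of_ge hAB h hc]
  rw [← intervalIntegral.integral_add_adjacent_intervals
    (intervalIntegrable_logReflect_exp a A (log ‖a‖)) (intervalIntegrable_logReflect_exp a _ B)]
  linarith [neg_six_le_integral_logReflect_of_le hB le_rfl hc,
    neg_six_le_integral_logReflect_of_ge hA le_rfl hc]

theorem integral_sum_logReflect (S : Multiset ℂ) {A B : ℝ} (hAB : A ≤ B) :
    IntervalIntegrable (fun s => (S.map fun a => logReflect a (exp s)).sum) volume A B ∧
      -12 * (S.card : ℝ) ≤ ∫ s in A..B, (S.map fun a => logReflect a (exp s)).sum := by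
  induction S using Multiset.induction with
  | empty => simp
  | cons a S ih =>
    simp only [Multiset.map_cons, Multiset.sum_cons, Multiset.card_cons]
    refine ⟨(intervalIntegrable_logReflect_exp a A B).add ih.1, ?_⟩
    rw [intervalIntegral.integral_add (intervalIntegrable_logReflect_exp a A B) ih.1]
    push_cast
    linarith [neg_twelve_le_integral_logReflect a hAB, ih.2]

theorem log_norm_multiset_prod {S : Multiset ℂ} (h : S.prod ≠ 0) :
    log ‖S.prod‖ = (S.map fun z => log ‖z‖).sum := by
  induction S using Multiset.induction with
  | empty => simp
  | cons a S ih =>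
    rw [Multiset.prod_cons] at h ⊢
    rw [norm_mul, Real.log_mul (by simpa using left_ne_zero_of_mul h)
      (by simpa using right_ne_zero_of_mul h), ih (right_ne_zero_of_mul h)]
    simp

theorem log_abs_eval_sub_log_abs_eval_neg (P : ℝ[X]) {x : ℝ} (h1 : P.eval x ≠ 0)
    (h2 : P.eval (-x) ≠ 0) :
    log |P.eval x| - log |P.eval (-x)| =
      ((P.map (algebraMap ℝ ℂ)).roots.map fun a => logReflect a x).sum := by
  set Q := P.map (algebraMap ℝ ℂ) with hQ
  have hlog {y : ℝ} (hy : P.eval y ≠ 0) :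
      log |P.eval y| = log ‖Q.leadingCoeff‖ + (Q.roots.map fun a => log ‖(y : ℂ) - a‖).sum := by
    have he : ((P.eval y : ℝ) : ℂ) = Q.eval (y : ℂ) := by
      rw [hQ, ← Complex.coe_algebraMap, Polynomial.eval_map_apply]
    have he' : Q.eval (y : ℂ) ≠ 0 := by rw [← he]; exact_mod_cast hy
    have hprod := (IsAlgClosed.splits Q).eval_eq_prod_roots (y : ℂ)
    rw [hprod] at he'
    rw [← Real.norm_eq_abs, ← Complex.norm_real, he, hprod, norm_mul,
      Real.log_mul (by simpa using left_ne_zero_of_mul he')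
        (norm_ne_zero_iff.mpr (right_ne_zero_of_mul he')),
      log_norm_multiset_prod (right_ne_zero_of_mul he'), Multiset.map_map]
    rfl
  have hneg (a : ℂ) : ‖((-x : ℝ) : ℂ) - a‖ = ‖(x : ℂ) + a‖ := by
    rw [← norm_neg]; congr 1; push_cast; ring
  rw [hlog h1, hlog h2, add_sub_add_left_eq_sub]
  simp only [hneg, logReflect, Multiset.sum_map_sub]

theorem countable_setOf_eval_exp_eq_zero {P : ℝ[X]} (hP : P ≠ 0) :
    {s : ℝ | P.eval (exp s) = 0}.Countable := by
  have : {s : ℝ | P.eval (exp s) = 0} = exp ⁻¹' (P.rootSet ℝ) := by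
    ext s
    simp [Polynomial.mem_rootSet, hP]
  rw [this]
  exact (P.rootSet_finite ℝ).countable.preimage exp_injective

theorem card_roots_map_complex_le (P : ℝ[X]) :
    (P.map (algebraMap ℝ ℂ)).roots.card ≤ P.natDegree :=
  (Polynomial.card_roots' _).trans Polynomial.natDegree_map_le

/-- If `p / q` is within `exp (-M) / 2` of `|x|` on `[-1, 1]`, then `M` is at most
root-linear in the degree. -/
theorem sq_le_of_approx_abs {n : ℕ} {p q : ℝ[X]} (hp : p.natDegree ≤ n) (hq : q.natDegree ≤ n)
    (hq0 : ∀ x ∈ Icc (-1 : ℝ) 1, q.eval x ≠ 0) {M : ℝ} (hM : 0 ≤ M)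
    (happ : ∀ x ∈ Icc (-1 : ℝ) 1, |(|x| - p.eval x / q.eval x)| ≤ 1 / 2 * exp (-M)) :
    M ^ 2 / 2 ≤ 12 * (2 * n + 1) := by
  set P : ℝ[X] := p - X * q with hPdef
  have hPdeg : P.natDegree ≤ n + 1 := by
    refine (Polynomial.natDegree_sub_le _ _).trans (max_le (by omega) ?_)
    have := Polynomial.natDegree_mul_le (p := (X : ℝ[X])) (q := q)
    rw [Polynomial.natDegree_X] at this
    omega
  have hPeval (y : ℝ) (hy : q.eval y ≠ 0) :
      P.eval y / q.eval y = p.eval y / q.eval y - y := by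
    simp [hPdef]
    field_simp
  have hnear {x : ℝ} (hx0 : 0 < x) (hx1 : x ≤ 1) :
      |P.eval x| ≤ 1 / 2 * exp (-M) * |q.eval x| := by
    have hmem : x ∈ Icc (-1 : ℝ) 1 := ⟨by linarith, hx1⟩
    have h := happ x hmem
    rw [abs_of_pos hx0, abs_sub_comm, ← hPeval x (hq0 x hmem), abs_div,
      div_le_iff₀ (abs_pos.mpr (hq0 x hmem))] at h
    exact h
  have hfar {x : ℝ} (hx0 : exp (-M) ≤ x) (hx1 : x ≤ 1) :
      x * |q.eval (-x)| ≤ |P.eval (-x)| := by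
    have hpos : 0 < x := (exp_pos _).trans_le hx0
    have hmem : -x ∈ Icc (-1 : ℝ) 1 := ⟨by linarith, by linarith⟩
    have h := happ (-x) hmem
    have he := hPeval (-x) (hq0 _ hmem)
    rw [abs_neg, abs_of_pos hpos] at h
    rw [← le_div_iff₀ (abs_pos.mpr (hq0 _ hmem)), ← abs_div, he]
    refine le_trans ?_ (le_abs_self _)
    linarith [(abs_le.mp h).2, exp_pos (-M)]
  have hP0 : P ≠ 0 := by
    intro h
    have h1 := hfar (x := 1) (exp_le_one_iff.mpr (by linarith)) le_rfl
    rw [h] at h1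
    have : q.eval (-1) ≠ 0 := hq0 (-1) ⟨le_rfl, by norm_num⟩
    have := abs_pos.mpr this
    simp at h1
    simp [h1] at this
  set S : Multiset ℂ := (P.map (algebraMap ℝ ℂ)).roots +
    (q.map (algebraMap ℝ ℂ)).roots.map Neg.neg with hS
  have hcard : (S.card : ℝ) ≤ 2 * n + 1 := by
    have : S.card ≤ 2 * n + 1 := by
      have h1 := card_roots_map_complex_le P
      have h2 := card_roots_map_complex_le q
      simp only [hS, Multiset.card_add, Multiset.card_map]
      omega
    exact_mod_cast this
  obtain ⟨hint, hlow⟩ := integral_sum_logReflect S (A := -M) (B := 0) (by linarith)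
  have hup : ∫ s in (-M)..0, (S.map fun a => logReflect a (exp s)).sum ≤
      ∫ s in (-M)..0, (-M - s) := by
    refine intervalIntegral.integral_mono_ae_restrict (by linarith) hint
      (Continuous.intervalIntegrable (by fun_prop) _ _) ?_
    have hae : ∀ᵐ s : ℝ ∂volume.restrict (Icc (-M) 0), P.eval (exp s) ≠ 0 :=
      ae_restrict_of_ae ((countable_setOf_eval_exp_eq_zero hP0).ae_notMem volume)
    filter_upwards [hae, ae_restrict_mem measurableSet_Icc] with s hs hsI
    have hx0 : exp (-M) ≤ exp s := exp_le_exp.mpr hsI.1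
    have hx1 : exp s ≤ 1 := exp_le_one_iff.mpr hsI.2
    have hpos := exp_pos s
    have hq1 : q.eval (exp s) ≠ 0 := hq0 _ ⟨by linarith, hx1⟩
    have hq2 : q.eval (-exp s) ≠ 0 := hq0 _ ⟨by linarith, by linarith⟩
    have hn := hnear hpos hx1
    have hf := hfar hx0 hx1
    have hP2 : P.eval (-exp s) ≠ 0 :=
      abs_pos.mp ((mul_pos hpos (abs_pos.mpr hq2)).trans_le hf)
    have eP := log_abs_eval_sub_log_abs_eval_neg P hs hP2
    have eq := log_abs_eval_sub_log_abs_eval_neg q hq1 hq2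
    have hsum : (S.map fun a => logReflect a (exp s)).sum =
        (log |P.eval (exp s)| - log |P.eval (-exp s)|) -
          (log |q.eval (exp s)| - log |q.eval (-exp s)|) := by
      rw [eP, eq, hS, Multiset.map_add, Multiset.sum_add, Multiset.map_map, sub_eq_add_neg]
      congr 1
      simp only [Function.comp_apply, logReflect_neg]
      exact Multiset.sum_map_neg
    rw [hsum]
    have hn' : log |P.eval (exp s)| ≤ -M + log |q.eval (exp s)| := by
      have hle : |P.eval (exp s)| ≤ exp (-M) * |q.eval (exp s)| := by
        nlinarith [mul_pos (exp_pos (-M)) (abs_pos.mpr hq1)]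
      have := Real.log_le_log (abs_pos.mpr hs) hle
      rwa [Real.log_mul (exp_pos _).ne' (abs_pos.mpr hq1).ne', Real.log_exp] at this
    have hf' : s + log |q.eval (-exp s)| ≤ log |P.eval (-exp s)| := by
      have := Real.log_le_log (mul_pos hpos (abs_pos.mpr hq2)) hf
      rwa [Real.log_mul hpos.ne' (abs_pos.mpr hq2).ne', Real.log_exp] at this
    linarith
  have hval : ∫ s in (-M)..0, (-M - s) = -(M ^ 2 / 2) := by
    rw [intervalIntegral.integral_sub (by simp) (Continuous.intervalIntegrable (by fun_prop) _ _)]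
    simp
    ring
  rw [hval] at hup
  linarith

/-- Newman's lower bound: no rational function of degree `n ≥ 4` approximates `|x|`
on `[-1, 1]` better than `(1/2) e^{-9√n}`. -/
theorem newman_lower_bound (n : ℕ) (hn : 4 ≤ n)
    (p q : Polynomial ℝ) (hp : p.natDegree ≤ n) (hq : q.natDegree ≤ n)
    (hq0 : ∀ x ∈ Set.Icc (-1 : ℝ) 1, q.eval x ≠ 0) :
    (1 / 2) * Real.exp (-9 * Real.sqrt n) ≤
      ⨆ x : Set.Icc (-1 : ℝ) 1, |(|(x : ℝ)| - p.eval (x : ℝ) / q.eval (x : ℝ))| := by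
  by_contra! hlt
  have hcont : Continuous fun x : Icc (-1 : ℝ) 1 =>
      |(|(x : ℝ)| - p.eval (x : ℝ) / q.eval (x : ℝ))| := by
    refine (continuous_subtype_val.abs.sub (Continuous.div ?_ ?_ fun x => hq0 x.1 x.2)).abs
    · exact p.continuous.comp continuous_subtype_val
    · exact q.continuous.comp continuous_subtype_val
  have hbdd := (isCompact_range hcont).bddAbove
  have h := sq_le_of_approx_abs hp hq hq0 (M := 9 * √n) (by positivity) fun x hx => by
    rw [← neg_mul]
    exact (le_ciSup hbdd ⟨x, hx⟩).trans hlt.le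
  rw [mul_pow, Real.sq_sqrt (Nat.cast_nonneg n)] at h
  have : (4 : ℝ) ≤ n := by exact_mod_cast hn
  linarith
end

section
/- There exists a constant c > 0 such that for every natural number n ≥ 1 and every real polynomial p of degree at most n, sup_{x ∈ [−1,1]} | |x| − p(x) | ≥ c / n. (Polynomial approximation of |x| on [−1,1] does no better than O(1/n).) -/
open Real intervalIntegral

/-- A nonzero integer frequency integrates to zero over a full period. -/
theorem integral_cos_nat_mul_add {k : ℕ} (hk : 0 < k) (φ : ℝ) :
    ∫ s in (0 : ℝ)..2 * π, cos (k * s + φ) = 0 := by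
  have hk' : (k : ℝ) ≠ 0 := by positivity
  rw [intervalIntegral.integral_comp_mul_add (fun x => cos x) hk', integral_cos]
  have h : sin (k * (2 * π) + φ) = sin φ := by
    rw [add_comm]; exact sin_add_nat_mul_two_pi φ k
  simp [h]

/-- Powers of `sin` are orthogonal to all higher frequencies. -/
theorem integral_sin_pow_mul_cos_nat_mul_add (m : ℕ) :
    ∀ {k : ℕ}, m < k → ∀ φ : ℝ, ∫ s in (0 : ℝ)..2 * π, sin s ^ m * cos (k * s + φ) = 0 := by
  induction m with
  | zero => intro k hk φ; simpa using integral_cos_nat_mul_add hk φ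
  | succ m ih =>
    intro k hk φ
    obtain ⟨l, rfl⟩ : ∃ l, k = l + 1 := ⟨k - 1, by omega⟩
    have h : ∀ s : ℝ, sin s ^ (m + 1) * cos ((l + 1 : ℕ) * s + φ) =
        1 / 2 * (sin s ^ m * cos ((l + 2 : ℕ) * s + (φ - π / 2))) -
          1 / 2 * (sin s ^ m * cos (l * s + (φ - π / 2))) := by
      intro s
      have h₁ : cos ((l + 2 : ℕ) * s + (φ - π / 2)) = sin (((l + 1 : ℕ) * s + φ) + s) := by
        rw [← cos_sub_pi_div_two]; congr 1; push_cast; ring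
      have h₂ : cos (l * s + (φ - π / 2)) = sin (((l + 1 : ℕ) * s + φ) - s) := by
        rw [← cos_sub_pi_div_two]; congr 1; push_cast; ring
      rw [h₁, h₂, sin_add, sin_sub]
      ring
    simp_rw [h]
    rw [integral_sub (by apply Continuous.intervalIntegrable; fun_prop)
      (by apply Continuous.intervalIntegrable; fun_prop), integral_const_mul, integral_const_mul,
      ih (by omega), ih (by omega)]
    simp

/-- Polynomials in `sin` are orthogonal to frequencies above their degree. -/
theorem integral_eval_sin_mul_cos {p : Polynomial ℝ} {k : ℕ} (hk : p.natDegree < k) :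
    ∫ s in (0 : ℝ)..2 * π, p.eval (sin s) * cos (k * s) = 0 := by
  simp_rw [Polynomial.eval_eq_sum_range, Finset.sum_mul, mul_assoc]
  rw [integral_finsetSum (fun i _ => by apply Continuous.intervalIntegrable; fun_prop)]
  refine Finset.sum_eq_zero fun i hi => ?_
  have h := integral_sin_pow_mul_cos_nat_mul_add i
    (lt_of_le_of_lt (Nat.lt_succ_iff.1 (Finset.mem_range.1 hi)) hk) 0
  simp only [add_zero] at h
  rw [integral_const_mul, h, mul_zero]

/-- The even Fourier coefficients of `|sin|`. -/
theorem integral_abs_sin_mul_cos {k : ℕ} (hk : 0 < k) :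
    ∫ s in (0 : ℝ)..2 * π, |sin s| * cos ((2 * k : ℕ) * s) = -4 / (4 * (k : ℝ) ^ 2 - 1) := by
  have hk1 : (1 : ℝ) ≤ k := by exact_mod_cast hk
  have ha : (2 * (k : ℝ) + 1) ≠ 0 := by positivity
  have hb : (2 * (k : ℝ) - 1) ≠ 0 := by linarith
  have hhalf : ∫ s in (0 : ℝ)..π, sin s * cos ((2 * k : ℕ) * s) =
      -2 / (4 * (k : ℝ) ^ 2 - 1) := by
    have h : ∀ s : ℝ, sin s * cos ((2 * k : ℕ) * s) =
        1 / 2 * sin ((2 * k + 1) * s) - 1 / 2 * sin ((2 * k - 1) * s) := by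
      intro s
      rw [add_mul, sub_mul, one_mul, sin_add, sin_sub]
      push_cast
      ring
    have hc₁ : cos ((2 * k + 1) * π) = -1 := by
      rw [show (2 * (k : ℝ) + 1) * π = π + k * (2 * π) by ring, cos_add_nat_mul_two_pi, cos_pi]
    have hc₂ : cos ((2 * k - 1) * π) = -1 := by
      rw [show (2 * (k : ℝ) - 1) * π = -π + k * (2 * π) by ring, cos_add_nat_mul_two_pi, cos_neg,
        cos_pi]
    simp_rw [h]
    rw [integral_sub (by apply Continuous.intervalIntegrable; fun_prop)
      (by apply Continuous.intervalIntegrable; fun_prop), integral_const_mul, integral_const_mul,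
      integral_comp_mul_left (fun x => sin x) ha, integral_comp_mul_left (fun x => sin x) hb,
      integral_sin, integral_sin, hc₁, hc₂]
    simp only [mul_zero, cos_zero, smul_eq_mul]
    rw [show 4 * (k : ℝ) ^ 2 - 1 = (2 * k + 1) * (2 * k - 1) by ring]
    field_simp
    ring
  have hperiod : Function.Periodic (fun s : ℝ => |sin s| * cos ((2 * k : ℕ) * s)) π := by
    intro s
    have : ((2 * k : ℕ) : ℝ) * (s + π) = (2 * k : ℕ) * s + k * (2 * π) := by push_cast; ring
    simp only [this, cos_add_nat_mul_two_pi, sin_add_pi, abs_neg]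
  have hfirst : ∫ s in (0 : ℝ)..π, |sin s| * cos ((2 * k : ℕ) * s) =
      -2 / (4 * (k : ℝ) ^ 2 - 1) := by
    rw [← hhalf]
    refine integral_congr fun s hs => ?_
    rw [Set.uIcc_of_le pi_pos.le] at hs
    simp only [abs_of_nonneg (sin_nonneg_of_mem_Icc hs)]
  have hsecond := hperiod.intervalIntegral_add_eq 0 π
  rw [zero_add, ← two_mul] at hsecond
  rw [← integral_add_adjacent_intervals (b := π)
    (by apply Continuous.intervalIntegrable; fun_prop)
    (by apply Continuous.intervalIntegrable; fun_prop), ← hsecond, hfirst]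
  ring

/-- The unnormalised Fejér kernel, in the doubled variable. -/
noncomputable def fejerSum (n : ℕ) (s : ℝ) : ℝ :=
  ∑ i ∈ Finset.range n, ∑ j ∈ Finset.range n, cos (2 * i * s - 2 * j * s)

theorem continuous_fejerSum (n : ℕ) : Continuous (fejerSum n) := by
  unfold fejerSum; fun_prop

theorem fejerSum_nonneg (n : ℕ) (s : ℝ) : 0 ≤ fejerSum n s := by
  have h : fejerSum n s = (∑ i ∈ Finset.range n, cos (2 * i * s)) ^ 2 +
      (∑ i ∈ Finset.range n, sin (2 * i * s)) ^ 2 := by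
    simp only [fejerSum, cos_sub, Finset.sum_add_distrib, sq, Finset.sum_mul_sum]
  rw [h]
  positivity

theorem integral_fejerSum (n : ℕ) : ∫ s in (0 : ℝ)..2 * π, fejerSum n s = 2 * π * n := by
  have key : ∀ i j : ℕ, ∫ s in (0 : ℝ)..2 * π, cos (2 * i * s - 2 * j * s) =
      if i = j then 2 * π else 0 := by
    intro i j
    rcases lt_trichotomy i j with h | h | h
    · rw [if_neg h.ne]
      refine Eq.trans ?_ (integral_cos_nat_mul_add (k := 2 * (j - i)) (by omega) 0)
      refine integral_congr fun s _ => ?_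
      rw [← cos_neg]
      push_cast [h.le]
      congr 1; ring
    · simp [h]
    · rw [if_neg h.ne']
      refine Eq.trans ?_ (integral_cos_nat_mul_add (k := 2 * (i - j)) (by omega) 0)
      refine integral_congr fun s _ => ?_
      push_cast [h.le]
      congr 1; ring
  unfold fejerSum
  rw [integral_finsetSum (fun i _ => by apply Continuous.intervalIntegrable; fun_prop)]
  have h : ∀ i ∈ Finset.range n, ∫ s in (0 : ℝ)..2 * π,
      ∑ j ∈ Finset.range n, cos (2 * i * s - 2 * j * s) = 2 * π := by
    intro i hi
    rw [integral_finsetSum (fun i _ => by apply Continuous.intervalIntegrable; fun_prop)]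
    simp_rw [key]
    rw [Finset.sum_ite_eq, if_pos hi]
  rw [Finset.sum_congr rfl h]
  simp [mul_comm]

/-- Frequency expansion of the modulated Fejér kernel. -/
theorem cos_mul_fejerSum (n : ℕ) (s : ℝ) :
    cos (4 * n * s) * fejerSum n s = ∑ i ∈ Finset.range n, ∑ j ∈ Finset.range n,
      1 / 2 * (cos ((2 * (2 * n + i - j) : ℕ) * s) + cos ((2 * (2 * n + j - i) : ℕ) * s)) := by
  unfold fejerSum
  simp_rw [Finset.mul_sum]
  refine Finset.sum_congr rfl fun i hi => Finset.sum_congr rfl fun j hj => ?_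
  rw [Finset.mem_range] at hi hj
  have h₁ : ((2 * (2 * n + i - j) : ℕ) : ℝ) * s = 4 * n * s + (2 * i * s - 2 * j * s) := by
    rw [Nat.cast_mul, Nat.cast_sub (by omega)]; push_cast; ring
  have h₂ : ((2 * (2 * n + j - i) : ℕ) : ℝ) * s = 4 * n * s - (2 * i * s - 2 * j * s) := by
    rw [Nat.cast_mul, Nat.cast_sub (by omega)]; push_cast; ring
  rw [h₁, h₂, cos_add, cos_sub (4 * n * s)]
  ring

/-- The frequencies of the error `|sin| - p(sin)` above the degree of `p` are those of `|sin|`. -/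
theorem integral_error_mul_cos_le {n k : ℕ} {p : Polynomial ℝ} (hp : p.natDegree ≤ n)
    (hnk : n < k) (hkn : k ≤ 3 * n) :
    ∫ s in (0 : ℝ)..2 * π, (|sin s| - p.eval (sin s)) * cos ((2 * k : ℕ) * s) ≤
      -(1 / (9 * (n : ℝ) ^ 2)) := by
  simp_rw [sub_mul]
  rw [integral_sub (by apply Continuous.intervalIntegrable; fun_prop)
      (by apply Continuous.intervalIntegrable; fun_prop),
    integral_abs_sin_mul_cos (by omega), integral_eval_sin_mul_cos (by omega), sub_zero, neg_div,
    neg_le_neg_iff]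
  have hk1 : (1 : ℝ) ≤ k := by exact_mod_cast (show 1 ≤ k by omega)
  have hn1 : (1 : ℝ) ≤ n := by exact_mod_cast (show 1 ≤ n by omega)
  have hkn' : (k : ℝ) ≤ 3 * n := by exact_mod_cast hkn
  rw [div_le_div_iff₀ (by positivity) (by nlinarith)]
  nlinarith

theorem integral_error_mul_kernel_le {n : ℕ} (hn : 1 ≤ n) {p : Polynomial ℝ}
    (hp : p.natDegree ≤ n) :
    ∫ s in (0 : ℝ)..2 * π, (|sin s| - p.eval (sin s)) * (cos (4 * n * s) * fejerSum n s) ≤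
      -(1 / 9) := by
  have hn0 : (n : ℝ) ≠ 0 := by positivity
  simp_rw [cos_mul_fejerSum, Finset.mul_sum]
  rw [integral_finsetSum (fun i _ => by apply Continuous.intervalIntegrable; fun_prop)]
  calc _ ≤ ∑ i ∈ Finset.range n, ∑ j ∈ Finset.range n, -(1 / (9 * (n : ℝ) ^ 2)) := by
        refine Finset.sum_le_sum fun i hi => ?_
        rw [integral_finsetSum (fun i _ => by apply Continuous.intervalIntegrable; fun_prop)]
        refine Finset.sum_le_sum fun j hj => ?_
        rw [Finset.mem_range] at hi hj
        simp_rw [mul_left_comm _ (1 / 2 : ℝ), mul_add]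
        rw [integral_add (by apply Continuous.intervalIntegrable; fun_prop)
          (by apply Continuous.intervalIntegrable; fun_prop), integral_const_mul,
          integral_const_mul]
        have h₁ := integral_error_mul_cos_le (k := 2 * n + i - j) hp (by omega) (by omega)
        have h₂ := integral_error_mul_cos_le (k := 2 * n + j - i) hp (by omega) (by omega)
        linarith
    _ = -(1 / 9) := by
        simp only [Finset.sum_const, Finset.card_range, nsmul_eq_mul]
        field_simp

/-- Polynomial approximation of `|x|` on `[-1, 1]` does no better than `O(1/n)`. -/
theorem abs_polynomial_approx_lower_bound :
    ∃ c : ℝ, 0 < c ∧ ∀ n : ℕ, 1 ≤ n → ∀ p : Polynomial ℝ, p.natDegree ≤ n →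
      c / n ≤ ⨆ x : Set.Icc (-1 : ℝ) 1, |(|(x : ℝ)| - p.eval (x : ℝ))| := by
  refine ⟨1 / (18 * π), by positivity, fun n hn p hp => ?_⟩
  set ε := ⨆ x : Set.Icc (-1 : ℝ) 1, |(|(x : ℝ)| - p.eval (x : ℝ))|
  have hbdd : BddAbove (Set.range fun x : Set.Icc (-1 : ℝ) 1 =>
      |(|(x : ℝ)| - p.eval (x : ℝ))|) :=
    (isCompact_range (by fun_prop)).bddAbove
  have hsup (s : ℝ) : |(|sin s| - p.eval (sin s))| ≤ ε :=
    le_ciSup hbdd ⟨sin s, neg_one_le_sin s, sin_le_one s⟩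
  have hcont := continuous_fejerSum n
  have hlower : ∫ s in (0 : ℝ)..2 * π, -(ε * fejerSum n s) ≤
      ∫ s in (0 : ℝ)..2 * π, (|sin s| - p.eval (sin s)) * (cos (4 * n * s) * fejerSum n s) := by
    refine integral_mono_on (by positivity) (by apply Continuous.intervalIntegrable; fun_prop)
      (by apply Continuous.intervalIntegrable; fun_prop) fun s _ => neg_le_of_abs_le ?_
    rw [abs_mul, abs_mul, abs_of_nonneg (fejerSum_nonneg n s)]
    refine mul_le_mul (hsup s) ?_ (mul_nonneg (abs_nonneg _) (fejerSum_nonneg n s))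
      ((abs_nonneg _).trans (hsup s))
    exact mul_le_of_le_one_left (fejerSum_nonneg n s) (abs_cos_le_one _)
  rw [integral_neg, integral_const_mul, integral_fejerSum] at hlower
  have hupper := integral_error_mul_kernel_le hn hp
  have hn0 : (0 : ℝ) < n := by exact_mod_cast hn
  rw [div_div, div_le_iff₀ (by positivity)]
  nlinarith
end

section
/- There exists a constant M > 0 such that for every natural number n ≥ 1 there is a real polynomial p of degree at most n with sup_{x ∈ [−1,1]} | |x| − p(x) | ≤ M / n. (Polynomials of degree n approximate |x| on [−1,1] with error O(1/n).) -/
open Polynomial in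
/-- The primitive of a real polynomial vanishing at `0` is a polynomial. -/
theorem exists_polynomial_eval_eq_integral (r : ℝ[X]) :
    ∃ s : ℝ[X], s.natDegree ≤ r.natDegree + 1 ∧ ∀ x, s.eval x = ∫ t in (0 : ℝ)..x, r.eval t := by
  refine ⟨∑ i ∈ Finset.range (r.natDegree + 1), monomial (i + 1) (r.coeff i / (i + 1)),
    natDegree_sum_le_of_forall_le _ _ fun i hi => ?_, fun x => ?_⟩
  · exact (natDegree_monomial_le _).trans (by simpa using hi)
  · simp_rw [eval_eq_sum_range (p := r), eval_finsetSum, eval_monomial]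
    rw [intervalIntegral.integral_finsetSum fun i _ =>
      (by fun_prop : Continuous fun t : ℝ => r.coeff i * t ^ i).intervalIntegrable _ _]
    refine Finset.sum_congr rfl fun i _ => ?_
    rw [intervalIntegral.integral_const_mul, integral_pow]
    simp
    ring

open Polynomial in
/-- If `q` is even, `|x q(x)| ≤ 1` on `[0, 1]` and `q ^ 2` has mass at least `A` on `[0, 1]`, then
a multiple of `x * ∫₀ˣ q ^ 2` approximates `|x|` up to `1 / A`. -/
theorem exists_polynomial_abs_sub_le_one_div {q : ℝ[X]} {A : ℝ} (hA : 0 < A)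
    (heven : ∀ x, q.eval (-x) = q.eval x)
    (hq : ∀ x ∈ Set.Icc (0 : ℝ) 1, |x * q.eval x| ≤ 1)
    (hmass : A ≤ ∫ t in (0 : ℝ)..1, q.eval t ^ 2) :
    ∃ p : ℝ[X], p.natDegree ≤ 2 * q.natDegree + 2 ∧
      ∀ x ∈ Set.Icc (-1 : ℝ) 1, |(|x| - p.eval x)| ≤ 1 / A := by
  obtain ⟨s, hsdeg, hs⟩ := exists_polynomial_eval_eq_integral (q ^ 2)
  simp only [eval_pow] at hs
  have hint (a b : ℝ) : IntervalIntegrable (fun t => q.eval t ^ 2) MeasureTheory.volume a b :=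
    (by fun_prop : Continuous fun t => q.eval t ^ 2).intervalIntegrable _ _
  rw [← hs] at hmass
  have hodd (x : ℝ) : s.eval (-x) = -s.eval x := by
    have h := intervalIntegral.integral_comp_neg (a := 0) (b := x) fun t => q.eval t ^ 2
    simp only [heven, neg_zero] at h
    rw [hs, hs, h, ← intervalIntegral.integral_symm]
  have hpos : 0 < s.eval 1 := hA.trans_le hmass
  have hnonneg (x : ℝ) (hx0 : 0 ≤ x) (hx1 : x ≤ 1) :
      |x - x * s.eval x / s.eval 1| ≤ 1 / A := by
    rcases hx0.eq_or_lt with rfl | hx0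
    · simpa using hA.le
    have htail : s.eval 1 - s.eval x = ∫ t in x..1, q.eval t ^ 2 := by
      rw [hs, hs, sub_eq_iff_eq_add', intervalIntegral.integral_add_adjacent_intervals] <;>
        exact hint _ _
    have hlow : 0 ≤ ∫ t in x..1, q.eval t ^ 2 :=
      intervalIntegral.integral_nonneg hx1 fun t _ => sq_nonneg _
    have hzero : (0 : ℝ) ∉ Set.uIcc x 1 := by
      rw [Set.uIcc_of_le hx1]
      exact fun h => hx0.not_ge h.1
    have hup : ∫ t in x..1, q.eval t ^ 2 ≤ 1 / x := by
      calc ∫ t in x..1, q.eval t ^ 2 ≤ ∫ t in x..1, t ^ (-2 : ℤ) := by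
            refine intervalIntegral.integral_mono_on hx1 (hint _ _)
              (intervalIntegral.intervalIntegrable_zpow (Or.inr hzero)) fun t ht => ?_
            have ht0 : 0 < t := hx0.trans_le ht.1
            have h := (sq_le_one_iff_abs_le_one _).2 (hq t ⟨ht0.le, ht.2⟩)
            rw [zpow_neg, ← one_div, le_div_iff₀ (by positivity)]
            norm_cast
            linarith [mul_pow t (q.eval t) 2]
        _ = 1 / x - 1 := by
            rw [integral_zpow (Or.inr ⟨by norm_num, hzero⟩)]
            norm_num
            ring
        _ ≤ 1 / x := by linarith
    have hprod : x * ∫ t in x..1, q.eval t ^ 2 ≤ 1 := by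
      calc _ ≤ x * (1 / x) := by gcongr
        _ = 1 := by field_simp
    have heq : x - x * s.eval x / s.eval 1 = (x * ∫ t in x..1, q.eval t ^ 2) / s.eval 1 := by
      rw [← htail]
      field_simp
    rw [heq, abs_of_nonneg (by positivity)]
    gcongr
  refine ⟨C (s.eval 1)⁻¹ * (X * s), ?_, fun x hx => ?_⟩
  · have h1 : (X * s : ℝ[X]).natDegree ≤ 1 + s.natDegree :=
      natDegree_mul_le.trans (by simp)
    have h2 : (q ^ 2).natDegree ≤ 2 * q.natDegree := natDegree_pow_le
    have h3 := natDegree_C_mul_le (s.eval 1)⁻¹ (X * s)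
    lia
  · have heval (y : ℝ) :
        (C (s.eval 1)⁻¹ * (X * s)).eval y = y * s.eval y / s.eval 1 := by
      simp
      ring
    rw [heval]
    rcases le_total 0 x with h | h
    · rw [abs_of_nonneg h]
      exact hnonneg x h hx.2
    · rw [abs_of_nonpos h]
      simpa [hodd] using hnonneg (-x) (by linarith) (by linarith [hx.1])

/-- Near the origin, a Chebyshev polynomial of odd degree grows at least linearly, with slope
proportional to its degree. -/
theorem Polynomial.Chebyshev.two_div_pi_mul_le_abs_eval_T_odd (m : ℕ) {x : ℝ} (hx0 : 0 ≤ x)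
    (hx : x ≤ 1 / (2 * m + 1)) :
    2 / Real.pi * (2 * m + 1) * x ≤ |(T ℝ (2 * m + 1)).eval x| := by
  have hN : (0 : ℝ) < 2 * m + 1 := by positivity
  have hx1 : x ≤ 1 := hx.trans (div_le_one_of_le₀ (by linarith [m.cast_nonneg (α := ℝ)]) hN.le)
  have hsin : Real.sin (Real.arcsin x) = x := Real.sin_arcsin (by linarith) hx1
  have hφ0 : 0 ≤ Real.arcsin x := Real.arcsin_nonneg.2 hx0
  have hle : x ≤ Real.arcsin x := hsin.symm.trans_le (Real.sin_le hφ0)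
  have hge : 2 / Real.pi * Real.arcsin x ≤ x :=
    (Real.mul_le_sin hφ0 (Real.arcsin_le_pi_div_two x)).trans_eq hsin
  have hNφ : (2 * m + 1) * Real.arcsin x ≤ Real.pi / 2 := by
    have h := hge.trans hx
    rw [le_div_iff₀ hN] at h
    have hπ := Real.pi_pos
    field_simp at h
    linarith
  have hT : (T ℝ (2 * m + 1)).eval x = (-1) ^ m * Real.sin ((2 * m + 1) * Real.arcsin x) := by
    nth_rw 1 [← hsin]
    rw [← Real.cos_pi_div_two_sub, T_real_cos, ← Real.cos_pi_div_two_sub,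
      ← Real.cos_add_nat_mul_pi]
    push_cast
    ring_nf
  rw [hT, abs_mul, abs_neg_one_pow, one_mul]
  calc 2 / Real.pi * (2 * m + 1) * x ≤ 2 / Real.pi * ((2 * m + 1) * Real.arcsin x) := by
        rw [mul_assoc]
        gcongr
    _ ≤ Real.sin ((2 * m + 1) * Real.arcsin x) := Real.mul_le_sin (by positivity) hNφ
    _ ≤ _ := le_abs_self _

open Polynomial in
/-- Polynomials of degree `4 * m + 2` approximate `|x|` on `[-1, 1]` up to
`π ^ 2 / (4 * (2 * m + 1))`. -/
theorem exists_polynomial_abs_sub_le_pi_sq_div (m : ℕ) :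
    ∃ p : ℝ[X], p.natDegree ≤ 4 * m + 2 ∧
      ∀ x ∈ Set.Icc (-1 : ℝ) 1, |(|x| - p.eval x)| ≤ Real.pi ^ 2 / (4 * (2 * m + 1)) := by
  have hN : (0 : ℝ) < 2 * m + 1 := by positivity
  have hNodd : Odd (2 * m + 1 : ℤ) := odd_two_mul_add_one _
  set t : ℝ[X] := Chebyshev.T ℝ (2 * m + 1) with ht
  have htq (x : ℝ) : x * t.divX.eval x = t.eval x := by
    have h0 : t.coeff 0 = 0 := by
      rw [coeff_zero_eq_eval_zero, ht, Chebyshev.T_eval_zero_of_odd ℝ hNodd]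
    conv_rhs => rw [← divX_mul_X_add t, h0]
    simp [mul_comm]
  have heven (x : ℝ) : t.divX.eval (-x) = t.divX.eval x := by
    rcases eq_or_ne x 0 with rfl | hx
    · simp
    · apply mul_left_cancel₀ hx
      have h := htq (-x)
      rw [ht, Chebyshev.T_eval_neg, ← ht, Int.negOnePow_odd _ hNodd, ← htq x] at h
      simpa using h
  have hdeg : t.divX.natDegree = 2 * m := by
    rw [natDegree_divX_eq_natDegree_tsub_one, ht, Chebyshev.natDegree_T]
    lia
  have hmass : 4 * (2 * m + 1) / Real.pi ^ 2 ≤ ∫ x in (0 : ℝ)..1, t.divX.eval x ^ 2 := by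
    have hint (a b : ℝ) :
        IntervalIntegrable (fun x => t.divX.eval x ^ 2) MeasureTheory.volume a b :=
      (by fun_prop : Continuous fun x => t.divX.eval x ^ 2).intervalIntegrable _ _
    calc 4 * (2 * m + 1) / Real.pi ^ 2
        = ∫ _ in (0 : ℝ)..1 / (2 * m + 1), (2 / Real.pi * (2 * m + 1)) ^ 2 := by
          rw [intervalIntegral.integral_const, smul_eq_mul]
          field_simp
          ring
      _ ≤ ∫ x in (0 : ℝ)..1 / (2 * m + 1), t.divX.eval x ^ 2 := by
          refine intervalIntegral.integral_mono_on_of_le_Ioo (by positivity) (by simp)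
            (hint _ _) fun x hx => ?_
          have h := Chebyshev.two_div_pi_mul_le_abs_eval_T_odd m hx.1.le hx.2.le
          rw [← ht, ← htq, abs_mul, abs_of_pos hx.1, mul_comm x] at h
          rw [← sq_abs (t.divX.eval x)]
          gcongr
          exact le_of_mul_le_mul_right h hx.1
      _ ≤ ∫ x in (0 : ℝ)..1, t.divX.eval x ^ 2 :=
          intervalIntegral.integral_mono_interval le_rfl (by positivity)
            (div_le_one_of_le₀ (by linarith [m.cast_nonneg (α := ℝ)]) hN.le)
            (Filter.Eventually.of_forall fun x => sq_nonneg _) (hint _ _)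
  obtain ⟨p, hp, happrox⟩ := exists_polynomial_abs_sub_le_one_div (q := t.divX)
    (div_pos (by positivity) (by positivity)) heven
    (fun x hx => by
      rw [htq]
      exact Chebyshev.abs_eval_T_real_le_one _ (abs_le.2 ⟨by linarith [hx.1], hx.2⟩)) hmass
  refine ⟨p, by lia, fun x hx => ?_⟩
  simpa only [one_div_div] using happrox x hx

/-- Polynomials of degree `n` approximate `|x|` on `[-1, 1]` with error `O(1/n)`. -/
theorem abs_polynomial_approx_upper_bound :
    ∃ M : ℝ, 0 < M ∧ ∀ n : ℕ, 1 ≤ n → ∃ p : Polynomial ℝ, p.natDegree ≤ n ∧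
      ∀ x ∈ Set.Icc (-1 : ℝ) 1, |(|x| - p.eval x)| ≤ M / n := by
  refine ⟨20, by norm_num, fun n hn => ?_⟩
  rcases hn.eq_or_lt with rfl | hn2
  · refine ⟨0, by simp, fun x hx => ?_⟩
    have := abs_le.2 hx
    simp
    linarith
  obtain ⟨p, hp, happrox⟩ := exists_polynomial_abs_sub_le_pi_sq_div ((n - 2) / 4)
  refine ⟨p, by lia, fun x hx => (happrox x hx).trans ?_⟩
  have hn5 : (n : ℝ) ≤ 5 * (2 * ((n - 2) / 4 : ℕ) + 1) := by
    exact_mod_cast (by lia : n ≤ 5 * (2 * ((n - 2) / 4) + 1))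
  have hn0 : (0 : ℝ) < n := by exact_mod_cast hn
  have hπ : Real.pi ^ 2 ≤ 16 := by nlinarith [Real.pi_pos, Real.pi_le_four]
  rw [div_le_div_iff₀ (by positivity) hn0]
  nlinarith [mul_le_mul_of_nonneg_right hπ hn0.le]
end

section
/- (Walsh's Hermite contour-integral error formula) Let R > 0, let f : ℂ → ℂ be holomorphic on an open set containing the closed disk {t : |t| ≤ R}, let z₀, …, z_n be distinct points with |z_k| < R for all k, and let π₁, …, π_n be points with |π_k| > R for all k. Define φ(w) = (∏_{k=0}^{n} (w − z_k)) / (∏_{k=1}^{n} (w − π_k)). Let p be a complex polynomial of degree at most n and let q(w) = ∏_{k=1}^{n} (w − π_k), and suppose the rational function r = p/q interpolates f at the points z_k, i.e. p(z_k) = f(z_k) · q(z_k) for 0 ≤ k ≤ n. Then for every z with |z| < R and z ∉ {π₁, …, π_n}, f(z) − p(z)/q(z) = (1/(2πi)) ∮_{|t| = R} (φ(z)/φ(t)) · (f(t)/(t − z)) dt, where the integral is the contour integral over the circle of radius R centered at 0 traversed counterclockwise. -/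
open scoped Real

/-- A holomorphic function vanishing at finitely many distinct points of an open set is divisible
by the corresponding nodal product. -/
theorem DifferentiableOn.exists_eq_prod_sub_mul {ι : Type*} {U : Set ℂ} (hU : IsOpen U)
    {g : ℂ → ℂ} (hg : DifferentiableOn ℂ g U) {z : ι → ℂ} (hz : Function.Injective z)
    (s : Finset ι) (hzU : ∀ k ∈ s, z k ∈ U) (hgz : ∀ k ∈ s, g (z k) = 0) :
    ∃ h : ℂ → ℂ, DifferentiableOn ℂ h U ∧ ∀ t, g t = (∏ k ∈ s, (t - z k)) * h t := by
  classical
  induction s using Finset.induction_on with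
  | empty => exact ⟨g, hg, by simp⟩
  | insert a s ha ih =>
    obtain ⟨h, hh, hgh⟩ := ih (fun k hk => hzU k (Finset.mem_insert_of_mem hk))
      (fun k hk => hgz k (Finset.mem_insert_of_mem hk))
    have haU := hzU a (Finset.mem_insert_self a s)
    have h_zero : h (z a) = 0 := by
      have hga := hgz a (Finset.mem_insert_self a s)
      rw [hgh, mul_eq_zero] at hga
      refine hga.resolve_left (Finset.prod_ne_zero_iff.mpr fun k hk => sub_ne_zero.mpr ?_)
      exact hz.ne fun hak => ha (hak ▸ hk)
    refine ⟨dslope h (z a), (Complex.differentiableOn_dslope (hU.mem_nhds haU)).mpr hh,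
      fun t => ?_⟩
    have hslope := sub_smul_dslope h (z a) t
    rw [h_zero, sub_zero, smul_eq_mul] at hslope
    rw [hgh, Finset.prod_insert ha, ← hslope]
    ring

theorem circleIntegrable_inv_sub_of_mem_ball {c a : ℂ} {R : ℝ} (ha : a ∈ Metric.ball c R) :
    CircleIntegrable (fun t => (t - a)⁻¹) c R := by
  rw [circleIntegrable_sub_inv_iff]
  refine Or.inr fun h => ?_
  rw [abs_of_pos (Metric.pos_of_mem_ball ha)] at h
  exact (Metric.mem_ball.mp ha).ne h

/-- Two simple poles inside the circle have opposite residues. -/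
theorem circleIntegral_inv_sub_mul_inv_sub {c a b : ℂ} {R : ℝ} (ha : a ∈ Metric.ball c R)
    (hb : b ∈ Metric.ball c R) (hab : a ≠ b) :
    ∮ t in C(c, R), (t - a)⁻¹ * (t - b)⁻¹ = 0 := by
  have hsplit : Set.EqOn (fun t => (t - a)⁻¹ * (t - b)⁻¹)
      (fun t => (a - b)⁻¹ * ((t - a)⁻¹ - (t - b)⁻¹)) (Metric.sphere c R) := by
    intro t ht
    have hta := sub_ne_zero.mpr (Metric.sphere_disjoint_ball.ne_of_mem ht ha)
    have htb := sub_ne_zero.mpr (Metric.sphere_disjoint_ball.ne_of_mem ht hb)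
    have hab' := sub_ne_zero.mpr hab
    simp only
    field_simp
    ring
  rw [circleIntegral.integral_congr (Metric.pos_of_mem_ball ha).le hsplit,
    circleIntegral.integral_const_mul,
    circleIntegral.integral_sub (circleIntegrable_inv_sub_of_mem_ball ha)
      (circleIntegrable_inv_sub_of_mem_ball hb),
    circleIntegral.integral_sub_inv_of_mem_ball ha,
    circleIntegral.integral_sub_inv_of_mem_ball hb, sub_self, mul_zero]

/-- If `p` has degree less than the number of distinct nodes, then `p(t) / (ω(t) (t - w))`, with `ω`
the nodal polynomial, integrates to zero over a circle enclosing the nodes and `w`. -/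
theorem circleIntegral_eval_div_prod_sub_div_sub {ι : Type*} {c w : ℂ} {R : ℝ}
    {z : ι → ℂ} (hz : Function.Injective z) (s : Finset ι) (hzR : ∀ k ∈ s, z k ∈ Metric.ball c R)
    (hw : w ∈ Metric.ball c R) (hwz : ∀ k ∈ s, z k ≠ w)
    {p : Polynomial ℂ} (hp : p.degree < s.card) :
    ∮ t in C(c, R), p.eval t / (∏ k ∈ s, (t - z k)) / (t - w) = 0 := by
  classical
  have hexpand : Set.EqOn (fun t => p.eval t / (∏ k ∈ s, (t - z k)) / (t - w))
      (fun t => ∑ k ∈ s, (Lagrange.nodalWeight s z k * p.eval (z k)) *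
        ((t - z k)⁻¹ * (t - w)⁻¹)) (Metric.sphere c R) := by
    intro t ht
    have htz : ∀ k ∈ s, t ≠ z k := fun k hk =>
      Metric.sphere_disjoint_ball.ne_of_mem ht (hzR k hk)
    have hω : ∏ k ∈ s, (t - z k) ≠ 0 :=
      Finset.prod_ne_zero_iff.mpr fun k hk => sub_ne_zero.mpr (htz k hk)
    simp only
    conv_lhs => rw [Lagrange.eq_interpolate hz.injOn hp]
    rw [Lagrange.eval_interpolate_not_at_node _ htz, Lagrange.eval_nodal,
      mul_div_cancel_left₀ _ hω, div_eq_mul_inv, Finset.sum_mul]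
    exact Finset.sum_congr rfl fun k _ => by ring
  have hR := Metric.pos_of_mem_ball hw
  rw [circleIntegral.integral_congr hR.le hexpand, circleIntegral.integral_fun_sum]
  · refine Finset.sum_eq_zero fun k hk => ?_
    rw [circleIntegral.integral_const_mul,
      circleIntegral_inv_sub_mul_inv_sub (hzR k hk) hw (hwz k hk), mul_zero]
  · intro k hk
    refine ContinuousOn.circleIntegrable hR.le fun t ht => ContinuousAt.continuousWithinAt ?_
    have hta := sub_ne_zero.mpr (Metric.sphere_disjoint_ball.ne_of_mem ht (hzR k hk))
    have htb := sub_ne_zero.mpr (Metric.sphere_disjoint_ball.ne_of_mem ht hw)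
    fun_prop (disch := assumption)

/-- Walsh's Hermite contour-integral error formula for rational interpolation. -/
theorem walsh_hermite_error_formula
    (R : ℝ) (hR : 0 < R) (f : ℂ → ℂ) (U : Set ℂ) (hU : IsOpen U)
    (hKU : Metric.closedBall (0 : ℂ) R ⊆ U) (hf : DifferentiableOn ℂ f U)
    (n : ℕ) (z : Fin (n + 1) → ℂ) (hz : Function.Injective z)
    (hzR : ∀ k, ‖z k‖ < R)
    (P : Fin n → ℂ) (hPR : ∀ k, R < ‖P k‖)
    (φ : ℂ → ℂ)
    (hφ : ∀ w : ℂ, φ w = (∏ k, (w - z k)) / (∏ k, (w - P k)))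
    (p : Polynomial ℂ) (hp : p.natDegree ≤ n)
    (q : ℂ → ℂ) (hqdef : ∀ w : ℂ, q w = ∏ k, (w - P k))
    (hinterp : ∀ k, p.eval (z k) = f (z k) * q (z k)) :
    ∀ w : ℂ, ‖w‖ < R → w ∉ Set.range P →
      f w - p.eval w / q w =
        (1 / (2 * Real.pi * Complex.I)) *
          ∮ t in C(0, R), (φ w / φ t) * (f t / (t - w)) := by
  intro w hw hwP
  have hzb : ∀ k, z k ∈ Metric.ball (0 : ℂ) R := fun k => by simpa using hzR k
  have hwb : w ∈ Metric.ball (0 : ℂ) R := by simpa using hw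
  have hq : ∀ t, ‖t‖ ≤ R → q t ≠ 0 := fun t ht => by
    rw [hqdef]
    refine Finset.prod_ne_zero_iff.mpr fun k _ => sub_ne_zero.mpr ?_
    rintro rfl
    exact (hPR k).not_ge ht
  have hqw := hq w hw.le
  by_cases hwz : ∃ k, z k = w
  · obtain ⟨k, rfl⟩ := hwz
    have hφ_zero : φ (z k) = 0 := by
      rw [hφ, Finset.prod_eq_zero (Finset.mem_univ k) (sub_self _), zero_div]
    simp [hφ_zero, hinterp, hqw, circleIntegral]
  push Not at hwz
  have hq_diff : Differentiable ℂ q := by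
    rw [funext hqdef]
    fun_prop
  obtain ⟨h, hh, hfac⟩ := DifferentiableOn.exists_eq_prod_sub_mul hU
    (g := fun t => f t * q t - p.eval t)
    ((hf.mul hq_diff.differentiableOn).sub p.differentiable.differentiableOn) hz Finset.univ
    (fun k _ => hKU (Metric.ball_subset_closedBall (hzb k)))
    (fun k _ => by simp [hinterp])
  have hhK : DifferentiableOn ℂ h (Metric.closedBall 0 R) := hh.mono hKU
  have htz : ∀ t ∈ Metric.sphere (0 : ℂ) R, ∏ k, (t - z k) ≠ 0 := fun t ht =>
    Finset.prod_ne_zero_iff.mpr fun k _ =>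
      sub_ne_zero.mpr (Metric.sphere_disjoint_ball.ne_of_mem ht (hzb k))
  have htw : ∀ t ∈ Metric.sphere (0 : ℂ) R, t - w ≠ 0 := fun t ht =>
    sub_ne_zero.mpr (Metric.sphere_disjoint_ball.ne_of_mem ht hwb)
  have hsplit : Set.EqOn (fun t => φ w / φ t * (f t / (t - w)))
      (fun t => φ w * ((t - w)⁻¹ • h t + p.eval t / (∏ k, (t - z k)) / (t - w)))
      (Metric.sphere 0 R) := by
    intro t ht
    have hωt := htz t ht
    have htw' := htw t ht
    have hqt := hq t (by simpa using (mem_sphere_zero_iff_norm.mp ht).le)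
    have hft := hfac t
    simp only [hφ t, ← hqdef, smul_eq_mul] at hft ⊢
    field_simp
    linear_combination φ w * hft
  have hint_h : CircleIntegrable (fun t => (t - w)⁻¹ • h t) 0 R := by
    refine ContinuousOn.circleIntegrable hR.le (ContinuousOn.fun_smul ?_
      (hhK.continuousOn.mono Metric.sphere_subset_closedBall))
    exact ContinuousOn.fun_inv₀ (by fun_prop) htw
  have hint_p : CircleIntegrable (fun t => p.eval t / (∏ k, (t - z k)) / (t - w)) 0 R := by
    refine ContinuousOn.circleIntegrable hR.le (ContinuousOn.div (ContinuousOn.div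
      p.continuous.continuousOn (by fun_prop) htz) (by fun_prop) htw)
  have hdeg : p.degree < (Finset.univ : Finset (Fin (n + 1))).card := by
    rw [Finset.card_fin]
    exact Polynomial.degree_le_natDegree.trans_lt (by exact_mod_cast Nat.lt_succ_of_le hp)
  rw [circleIntegral.integral_congr hR.le hsplit, circleIntegral.integral_const_mul,
    circleIntegral.integral_add hint_h hint_p,
    circleIntegral_eval_div_prod_sub_div_sub hz Finset.univ (fun k _ => hzb k) hwb
      (fun k _ => hwz k) hdeg,
    hhK.circleIntegral_sub_inv_smul hwb, add_zero, smul_eq_mul]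
  have hfw := hfac w
  have hpi := Complex.two_pi_I_ne_zero
  rw [hφ w, ← hqdef, one_div, mul_left_comm, inv_mul_cancel_left₀ hpi]
  field_simp
  linear_combination hfw
end

section
/- Let f(z) = √(1.5 − z) on the closed unit disk, where √ denotes the principal branch of the complex square root (well-defined since Re(1.5 − z) ≥ 0.5 > 0 for |z| ≤ 1). Then there exist ρ with 0 < ρ < 1 and a natural number N such that for every n ≥ N and all complex polynomials p and q each of degree at most n with q nonvanishing on the closed unit disk, sup_{|z| ≤ 1} | f(z) − p(z)/q(z) | ≥ ρ^n. (A branch point at z = 1.5 forces rational approximation on the unit disk to converge no faster than exponentially: the rational minimax errors are not superexponentially small.) -/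
open Polynomial in
/-- The Bernstein–Walsh inequality on disks. -/
lemma norm_eval_le_of_norm_eval_le_on_unit_disk {P : ℂ[X]} {N : ℕ} (hP : P.natDegree ≤ N) {M R : ℝ}
    (hM : ∀ z : ℂ, ‖z‖ ≤ 1 → ‖P.eval z‖ ≤ M) (hR : 1 ≤ R) {z : ℂ} (hz : ‖z‖ ≤ R) :
    ‖P.eval z‖ ≤ M * R ^ N := by
  have hM0 : 0 ≤ M := (norm_nonneg _).trans (hM 0 (by simp))
  rcases le_total ‖z‖ 1 with h | h
  · exact (hM z h).trans (le_mul_of_one_le_right hM0 (one_le_pow₀ hR))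
  have key : ∀ w : ℂ, w ≠ 0 → (reflect N P).eval w⁻¹ * w ^ N = P.eval w := by
    intro w hw
    let := invertibleOfNonzero hw
    simpa [eval₂_id] using eval₂_reflect_mul_pow (RingHom.id ℂ) w N P hP
  have hz0 : z ≠ 0 := norm_pos_iff.1 (by linarith)
  have hbound : ‖(reflect N P).eval z⁻¹‖ ≤ M := by
    refine Complex.norm_le_of_forall_mem_frontier_norm_le (U := Metric.ball 0 1)
      Metric.isBounded_ball (reflect N P).differentiable.diffContOnCl (fun w hw => ?_) ?_
    · rw [frontier_ball _ one_ne_zero, mem_sphere_zero_iff_norm] at hw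
      have hw0 : w ≠ 0 := norm_pos_iff.1 (by linarith)
      have h1 := congrArg norm (key w⁻¹ (inv_ne_zero hw0))
      rw [inv_inv, norm_mul, norm_pow, norm_inv, hw, inv_one, one_pow, mul_one] at h1
      rw [h1]
      exact hM _ (by simp [hw])
    · rw [closure_ball _ one_ne_zero, mem_closedBall_zero_iff, norm_inv]
      exact inv_le_one_of_one_le₀ h
  rw [← key z hz0, norm_mul, norm_pow]
  gcongr

open Polynomial in
/-- A monic real-rooted polynomial with nonnegative roots is, somewhere on `[0, 1]`, at least
exponentially comparable to its modulus at `-5/2`. The proof applies the maximum principle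
after the Joukowski substitution `r = 1/2 + (w + w⁻¹) / 4`. -/
lemma exists_prod_le_prod_abs_sub (S : Multiset ℝ) (hS : ∀ b ∈ S, 0 ≤ b) :
    ∃ r : ℝ, 0 ≤ r ∧ r ≤ 1 ∧
      (S.map fun b => (b + 5 / 2) / 12).prod ≤ (S.map fun b => |r - b|).prod := by
  set F : ℂ[X] :=
    (S.map fun b : ℝ => X * C (1 / 2 - (b : ℂ)) + C (1 / 4) * (X ^ 2 + 1)).prod with hF
  have hFnorm : ∀ w : ℂ, ‖F.eval w‖ =
      (S.map fun b : ℝ => ‖w * (1 / 2 - (b : ℂ)) + 1 / 4 * (w ^ 2 + 1)‖).prod := by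
    intro w
    rw [hF, eval_multiset_prod, ← coe_nnnorm, ← nnnormHom_apply, map_multiset_prod,
      NNReal.coe_multiset_prod]
    simp only [Multiset.map_map]
    congr 1
    refine Multiset.map_congr rfl fun b _ => ?_
    simp
  obtain ⟨w, hw, hmax⟩ := Complex.exists_mem_frontier_isMaxOn_norm (U := Metric.ball (0 : ℂ) 1)
    Metric.isBounded_ball ⟨0, by simp⟩ F.differentiable.diffContOnCl
  rw [frontier_ball _ one_ne_zero, mem_sphere_zero_iff_norm] at hw
  have hre := abs_le.1 ((Complex.abs_re_le_norm w).trans hw.le)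
  refine ⟨(1 + w.re) / 2, by linarith, by linarith, ?_⟩
  have hle : ‖F.eval (-1 / 12)‖ ≤ ‖F.eval w‖ := hmax (by
    rw [closure_ball _ one_ne_zero, mem_closedBall_zero_iff]; norm_num)
  rw [hFnorm, hFnorm] at hle
  refine (Multiset.prod_map_le_prod_map₀ _ _ (fun b hb => ?_) fun b hb => ?_).trans (hle.trans_eq ?_)
  · have := hS b hb
    positivity
  · have hb0 := hS b hb
    have : (-1 / 12 * (1 / 2 - (b : ℂ)) + 1 / 4 * ((-1 / 12) ^ 2 + 1)) =
        ((b / 12 + 121 / 576 : ℝ) : ℂ) := by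
      push_cast; ring
    rw [this, Complex.norm_real, Real.norm_eq_abs]
    refine le_trans ?_ (le_abs_self _)
    linarith
  · congr 1
    refine Multiset.map_congr rfl fun b _ => ?_
    have hconj : w * (starRingEnd ℂ) w = 1 := by
      rw [Complex.mul_conj, Complex.normSq_eq_norm_sq, hw]; norm_num
    have hadd : w + (starRingEnd ℂ) w = 2 * (w.re : ℂ) := by
      rw [Complex.add_conj]; push_cast; ring
    have : w * (1 / 2 - (b : ℂ)) + 1 / 4 * (w ^ 2 + 1) =
        w * (((1 + w.re) / 2 - b : ℝ) : ℂ) := by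
      push_cast
      linear_combination (-1 / 4 : ℂ) * hconj + (w / 4) * hadd
    rw [this, norm_mul, hw, one_mul, Complex.norm_real, Real.norm_eq_abs]

open Polynomial in
/-- A polynomial `q` of degree at most `n` is at least exponentially comparable to its maximum on
the unit disk along some circle of radius at most `1` about any point `c` with `‖c‖ ≤ 3/2`. -/
lemma exists_circle_le_norm_eval {q : ℂ[X]} (hq : q ≠ 0) {n : ℕ} (hn : q.natDegree ≤ n) {c : ℂ}
    (hc : ‖c‖ ≤ 3 / 2) :
    ∃ B r : ℝ, 0 < B ∧ 0 < r ∧ r ≤ 1 ∧ (∀ z : ℂ, ‖z‖ ≤ 1 → ‖q.eval z‖ ≤ B) ∧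
      ∀ z : ℂ, ‖z - c‖ = r → 5 / 24 * B ≤ 12 ^ n * (r * ‖q.eval z‖) := by
  have hnorm : ∀ z : ℂ, ‖q.eval z‖ =
      ‖q.leadingCoeff‖ * (q.roots.map fun a => ‖z - a‖).prod := by
    intro z
    rw [(IsAlgClosed.splits q).eval_eq_prod_roots, norm_mul, ← coe_nnnorm (Multiset.prod _),
      ← nnnormHom_apply, map_multiset_prod, NNReal.coe_multiset_prod]
    simp [Multiset.map_map, Function.comp_def]
  have hlc : 0 < ‖q.leadingCoeff‖ := norm_pos_iff.2 (leadingCoeff_ne_zero.2 hq)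
  obtain ⟨r, hr0, hr1, hr⟩ := exists_prod_le_prod_abs_sub
    (0 ::ₘ q.roots.map fun a => ‖a - c‖) (by simp; intros; subst_vars; positivity)
  simp only [Multiset.map_cons, Multiset.prod_cons, Multiset.map_map, Function.comp_def,
    sub_zero, zero_add, abs_of_nonneg hr0] at hr
  have hdiv : (q.roots.map fun a => (‖a - c‖ + 5 / 2) / 12).prod =
      (q.roots.map fun a => ‖a - c‖ + 5 / 2).prod / 12 ^ (Multiset.card q.roots) := by
    rw [Multiset.prod_map_div]; simp
  have hBpos : 0 < (q.roots.map fun a => ‖a - c‖ + 5 / 2).prod := by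
    refine Multiset.prod_pos fun x hx => ?_
    obtain ⟨a, -, rfl⟩ := Multiset.mem_map.1 hx
    positivity
  set A := (q.roots.map fun a => ‖a - c‖ + 5 / 2).prod
  have hcard : (12 : ℝ) ^ (Multiset.card q.roots) ≤ 12 ^ n :=
    pow_le_pow_right₀ (by norm_num) ((card_roots' q).trans hn)
  have hrpos : 0 < r := by
    refine hr0.lt_of_ne fun h => ?_
    rw [← h, zero_mul, hdiv] at hr
    have : 0 < 5 / 2 / 12 * (A / 12 ^ (Multiset.card q.roots)) := by positivity
    linarith
  refine ⟨‖q.leadingCoeff‖ * A, r, by positivity, hrpos, hr1, fun z hz => ?_, fun z hz => ?_⟩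
  · rw [hnorm]
    refine mul_le_mul_of_nonneg_left ?_ hlc.le
    refine Multiset.prod_map_le_prod_map₀ _ _ (fun _ _ => norm_nonneg _) fun a _ => ?_
    calc ‖z - a‖ = ‖z - c - (a - c)‖ := by congr 1; ring
      _ ≤ ‖z‖ + ‖c‖ + ‖a - c‖ := (norm_sub_le _ _).trans (by gcongr; exact norm_sub_le _ _)
      _ ≤ _ := by linarith
  · have hprod : (q.roots.map fun a => |r - ‖a - c‖|).prod ≤
        (q.roots.map fun a => ‖z - a‖).prod := by
      refine Multiset.prod_map_le_prod_map₀ _ _ (fun _ _ => abs_nonneg _) fun a _ => ?_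
      rw [← hz]
      refine (abs_norm_sub_norm_le _ _).trans_eq ?_
      congr 1; ring
    rw [hnorm]
    have h12 : (0 : ℝ) < 12 ^ (Multiset.card q.roots) := by positivity
    have h1 : 5 / 24 * A ≤ 12 ^ n * (r * (q.roots.map fun a => ‖z - a‖).prod) := by
      have h2 := hr.trans (mul_le_mul_of_nonneg_left hprod hr0)
      rw [hdiv, ← mul_div_assoc, div_le_iff₀ h12] at h2
      have h3 : 0 ≤ r * (q.roots.map fun a => ‖z - a‖).prod := by
        refine mul_nonneg hr0 (Multiset.prod_nonneg fun x hx => ?_)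
        obtain ⟨a, -, rfl⟩ := Multiset.mem_map.1 hx
        positivity
      have h4 := mul_le_mul_of_nonneg_left hcard h3
      linarith
    nlinarith [mul_le_mul_of_nonneg_left h1 hlc.le]

/-- If `g` does not vanish on a circle about `c`, then `(c - z) * g z ^ 2` has no continuous square
root there, and neither does any perturbation of it that is small relative to its modulus. -/
lemma exists_norm_le_norm_sq_sub_on_circle {f g : ℂ → ℂ} (hf : Continuous f) (hg : Continuous g)
    {c : ℂ} {r : ℝ} (hr : 0 < r) :
    ∃ z : ℂ, ‖z - c‖ = r ∧ r * ‖g z‖ ^ 2 ≤ ‖f z ^ 2 - (c - z) * g z ^ 2‖ := by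
  by_contra! hlt
  set ζ : ℝ → ℂ := fun θ => c - r * Complex.exp (θ * Complex.I) with hζ
  have hζc : Continuous ζ := by fun_prop
  have hζr : ∀ θ, ‖ζ θ - c‖ = r := fun θ => by
    simp [hζ, Complex.norm_exp_ofReal_mul_I, abs_of_pos hr]
  have hgne : ∀ θ, g (ζ θ) ≠ 0 := fun θ h => by
    have := hlt _ (hζr θ)
    rw [h] at this
    simp at this
    linarith [norm_nonneg (f (ζ θ)), sq_nonneg ‖f (ζ θ)‖]
  have hcne : ∀ θ, c - ζ θ ≠ 0 := fun θ h => by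
    have := hζr θ
    rw [norm_sub_rev, h, norm_zero] at this
    exact hr.ne this
  set u : ℝ → ℂ := fun θ => f (ζ θ) ^ 2 / ((c - ζ θ) * g (ζ θ) ^ 2) with hu
  have hu1 : ∀ θ, ‖u θ - 1‖ < 1 := fun θ => by
    have hne : (c - ζ θ) * g (ζ θ) ^ 2 ≠ 0 := mul_ne_zero (hcne θ) (pow_ne_zero 2 (hgne θ))
    rw [hu, div_sub_one hne, norm_div, div_lt_one (norm_pos_iff.2 hne), norm_mul, norm_pow,
      norm_sub_rev c, hζr]
    exact hlt _ (hζr θ)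
  have huslit : ∀ θ, u θ ∈ Complex.slitPlane := fun θ => by
    refine Or.inl ?_
    have h1 := (Complex.abs_re_le_norm (u θ - 1)).trans_lt (hu1 θ)
    rw [Complex.sub_re, Complex.one_re] at h1
    linarith [(abs_lt.1 h1).1]
  have huc : Continuous u := by
    refine Continuous.div (by fun_prop) (by fun_prop) fun θ => ?_
    exact mul_ne_zero (hcne θ) (pow_ne_zero 2 (hgne θ))
  set v : ℝ → ℂ := fun θ => u θ ^ (1 / 2 : ℂ) with hv
  have hvc : Continuous v := huc.cpow continuous_const huslit
  have hvsq : ∀ θ, v θ ^ 2 = u θ := fun θ => by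
    simp only [hv]
    rw [← Complex.cpow_nat_mul]; norm_num
  set G : ℝ → ℂ := fun θ => g (ζ θ) * v θ * (√r * Complex.exp (θ / 2 * Complex.I)) with hG
  have hGc : Continuous G := by fun_prop
  have hGne : ∀ θ, G θ ≠ 0 := fun θ => by
    have hv0 : v θ ≠ 0 := fun h => by
      have h1 := hvsq θ
      rw [h] at h1
      exact Complex.slitPlane_ne_zero (huslit θ) (by rw [← h1]; norm_num)
    have hsq : (√r : ℂ) ≠ 0 := by exact_mod_cast (Real.sqrt_pos.2 hr).ne'
    exact mul_ne_zero (mul_ne_zero (hgne θ) hv0) (mul_ne_zero hsq (Complex.exp_ne_zero _))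
  have hsq : ∀ θ, f (ζ θ) ^ 2 = G θ ^ 2 := fun θ => by
    have h1 : (√r : ℂ) ^ 2 = r := by exact_mod_cast Real.sq_sqrt hr.le
    have h2 : Complex.exp (θ / 2 * Complex.I) ^ 2 = Complex.exp (θ * Complex.I) := by
      rw [← Complex.exp_nat_mul]; congr 1; push_cast; ring
    have h3 : G θ ^ 2 = g (ζ θ) ^ 2 * u θ * (c - ζ θ) := by
      simp only [hG, mul_pow, hvsq, h1, h2, hζ]; ring
    have h4 := hcne θ
    have h5 := hgne θ
    rw [h3, hu]
    field_simp
  have hper : ζ (2 * Real.pi) = ζ 0 := by simp [hζ]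
  have hanti : G (2 * Real.pi) = -G 0 := by
    have h1 : Complex.exp (((2 * Real.pi : ℝ) : ℂ) / 2 * Complex.I) = -1 := by
      rw [← Complex.exp_pi_mul_I]; congr 1; push_cast; ring
    have h2 : v (2 * Real.pi) = v 0 := by simp only [hv, hu, hper]
    simp only [hG]
    rw [h1, h2, hper]
    simp
  have hfper : f (ζ (2 * Real.pi)) = f (ζ 0) := by rw [hper]
  have hG0 := hGne 0
  rcases isPreconnected_univ.eq_or_eq_neg_of_sq_eq (f := fun θ => f (ζ θ)) (g := G)
    (hf.comp hζc).continuousOn hGc.continuousOn (fun θ _ => hsq θ) (fun {θ} _ => hGne θ) with h | h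
  · have h1 := h (Set.mem_univ (2 * Real.pi))
    have h2 := h (Set.mem_univ 0)
    simp only at h1 h2
    rw [hfper, h2, hanti] at h1
    exact hG0 (self_eq_neg.1 h1)
  · have h1 := h (Set.mem_univ (2 * Real.pi))
    have h2 := h (Set.mem_univ 0)
    simp only [Pi.neg_apply] at h1 h2
    rw [hfper, h2, hanti, neg_neg] at h1
    exact hG0 (neg_eq_self.1 h1)

/-- A branch point at `z = 1.5` forces rational approximation of `√(1.5 - z)` on the
closed unit disk to converge no faster than exponentially: rational minimax errors
are not superexponentially small. -/
theorem branch_point_rational_approx_exponential_lower_bound :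
    ∃ ρ : ℝ, 0 < ρ ∧ ρ < 1 ∧ ∃ N : ℕ, ∀ n : ℕ, N ≤ n →
      ∀ p q : Polynomial ℂ, p.natDegree ≤ n → q.natDegree ≤ n →
        (∀ z ∈ Metric.closedBall (0 : ℂ) 1, q.eval z ≠ 0) →
        ρ ^ n ≤ ⨆ z : Metric.closedBall (0 : ℂ) 1,
          ‖((3 / 2 : ℂ) - z) ^ (1 / 2 : ℂ) - p.eval (z : ℂ) / q.eval (z : ℂ)‖ := by
  refine ⟨1 / (900 * 288), by norm_num, by norm_num, 1, fun n hn p q hp hq hq0 => ?_⟩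
  by_contra! hlt
  set ε := ⨆ z : Metric.closedBall (0 : ℂ) 1,
    ‖((3 / 2 : ℂ) - z) ^ (1 / 2 : ℂ) - p.eval (z : ℂ) / q.eval (z : ℂ)‖ with hε
  have hcont : Continuous fun z : Metric.closedBall (0 : ℂ) 1 =>
      ‖((3 / 2 : ℂ) - z) ^ (1 / 2 : ℂ) - p.eval (z : ℂ) / q.eval (z : ℂ)‖ := by
    have hslit : ∀ z : Metric.closedBall (0 : ℂ) 1, (3 / 2 : ℂ) - z ∈ Complex.slitPlane := by
      intro z
      have h1 := (Complex.re_le_norm (z : ℂ)).trans (mem_closedBall_zero_iff.1 z.2)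
      have h2 : ((3 / 2 : ℂ) - z).re = 3 / 2 - (z : ℂ).re := by norm_num
      exact Or.inl (by rw [h2]; linarith)
    have hsqrt : Continuous fun z : Metric.closedBall (0 : ℂ) 1 =>
        ((3 / 2 : ℂ) - z) ^ (1 / 2 : ℂ) :=
      Continuous.cpow (by fun_prop) continuous_const hslit
    have hquot : Continuous fun z : Metric.closedBall (0 : ℂ) 1 =>
        p.eval (z : ℂ) / q.eval (z : ℂ) :=
      (p.continuous.comp continuous_subtype_val).div (q.continuous.comp continuous_subtype_val)
        fun z => hq0 z z.2
    exact (hsqrt.sub hquot).norm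
  have hpt : ∀ z : ℂ, ‖z‖ ≤ 1 →
      ‖((3 / 2 : ℂ) - z) ^ (1 / 2 : ℂ) - p.eval z / q.eval z‖ ≤ ε := fun z hz =>
    le_ciSup (isCompact_range hcont).bddAbove ⟨z, mem_closedBall_zero_iff.2 hz⟩
  have hε0 : 0 ≤ ε := (norm_nonneg _).trans (hpt 0 (by simp))
  have hε1 : ε ≤ 1 := hlt.le.trans (pow_le_one₀ (by norm_num) (by norm_num))
  have hqne : q ≠ 0 := fun h => hq0 0 (by simp) (by simp [h])
  obtain ⟨B, r, hB, hr0, hr1, hqB, hqr⟩ := exists_circle_le_norm_eval hqne hq (c := 3 / 2)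
    (by norm_num)
  set P : Polynomial ℂ := p ^ 2 - (Polynomial.C (3 / 2) - Polynomial.X) * q ^ 2 with hP
  have hPeval : ∀ z, P.eval z = p.eval z ^ 2 - (3 / 2 - z) * q.eval z ^ 2 := by simp [hP]
  have hPdeg : P.natDegree ≤ 2 * n + 1 := by
    refine (Polynomial.natDegree_sub_le _ _).trans (max_le ?_ ?_)
    · exact Polynomial.natDegree_pow_le.trans (by lia)
    · refine Polynomial.natDegree_mul_le.trans ?_
      have h1 : (q ^ 2).natDegree ≤ 2 * q.natDegree := Polynomial.natDegree_pow_le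
      have h2 : (Polynomial.C (3 / 2 : ℂ) - Polynomial.X).natDegree ≤ 1 := by compute_degree
      lia
  have hPdisk : ∀ z : ℂ, ‖z‖ ≤ 1 → ‖P.eval z‖ ≤ 5 * ε * B ^ 2 := by
    intro z hz
    have hqz : q.eval z ≠ 0 := hq0 z (mem_closedBall_zero_iff.2 hz)
    have herr := hpt z hz
    set s := ((3 / 2 : ℂ) - z) ^ (1 / 2 : ℂ) with hs
    have hs2 : s ^ 2 = 3 / 2 - z := by rw [hs, ← Complex.cpow_nat_mul]; norm_num
    have hsn : ‖s‖ ≤ 2 := by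
      have h1 : ‖s‖ ^ 2 ≤ 5 / 2 := by
        rw [← norm_pow, hs2]
        refine (norm_sub_le _ _).trans ?_
        norm_num
        linarith
      nlinarith [norm_nonneg s]
    have hfac : P.eval z =
        -((s - p.eval z / q.eval z) * (2 * s - (s - p.eval z / q.eval z)) * q.eval z ^ 2) := by
      rw [hPeval, ← hs2]
      field_simp
      ring
    have hsum : ‖2 * s - (s - p.eval z / q.eval z)‖ ≤ 5 := by
      refine (norm_sub_le _ _).trans ?_
      rw [norm_mul, Complex.norm_two]
      linarith
    rw [hfac, norm_neg, norm_mul, norm_mul, norm_pow, mul_comm 5 ε]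
    gcongr
    exact hqB z hz
  obtain ⟨z, hzr, hz⟩ := exists_norm_le_norm_sq_sub_on_circle p.continuous q.continuous
    (c := 3 / 2) hr0
  rw [← hPeval] at hz
  have hzn : ‖z‖ ≤ 5 / 2 := by
    calc ‖z‖ = ‖z - 3 / 2 + 3 / 2‖ := by simp
      _ ≤ r + ‖(3 / 2 : ℂ)‖ := (norm_add_le _ _).trans_eq (by rw [hzr])
      _ ≤ 5 / 2 := by norm_num; linarith
  have hPz := hz.trans (norm_eval_le_of_norm_eval_le_on_unit_disk hPdeg hPdisk (by norm_num) hzn)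
  have hlow := pow_le_pow_left₀ (by positivity) (hqr z hzr) 2
  have hr2 : (r * ‖q.eval z‖) ^ 2 ≤ r * ‖q.eval z‖ ^ 2 := by
    have : r ^ 2 ≤ r := by nlinarith
    rw [mul_pow]
    gcongr
  have h144 : (0 : ℝ) < (12 ^ n) ^ 2 := by positivity
  have hfinal : (5 / 24 * B) ^ 2 ≤ (12 ^ n) ^ 2 * (5 * ε * B ^ 2 * (5 / 2) ^ (2 * n + 1)) := by
    rw [mul_pow (12 ^ n) (r * _)] at hlow
    exact hlow.trans (mul_le_mul_of_nonneg_left (hr2.trans hPz) h144.le)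
  have h900 : (12 ^ n) ^ 2 * (5 * ε * B ^ 2 * (5 / 2) ^ (2 * n + 1)) =
      25 / 2 * (900 ^ n * ε) * B ^ 2 := by
    have : (900 : ℝ) ^ n = (12 ^ n) ^ 2 * (5 / 2) ^ (2 * n) := by
      rw [← pow_mul, mul_comm n 2, ← mul_pow, pow_mul]; norm_num
    rw [this]; ring
  have hsmall : 900 ^ n * ε < 1 / 288 := by
    calc 900 ^ n * ε < 900 ^ n * (1 / (900 * 288)) ^ n := by gcongr
      _ = (1 / 288) ^ n := by rw [← mul_pow]; norm_num
      _ ≤ (1 / 288) ^ 1 := pow_le_pow_of_le_one (by norm_num) (by norm_num) hn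
      _ = 1 / 288 := pow_one _
  rw [h900] at hfinal
  nlinarith [mul_lt_mul_of_pos_right hsmall (pow_pos hB 2)]
end
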